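/- arXiv:1511.04937 — 2 statements merged into one kernel-verified Lean document; each statement's English description precedes it below -/
import Mathlib

section
/- Let b ≥ 2, let σ be a permutation of {0,…,b−1} with σ∘τ = τ∘σ, let n ≥ 1, and let Σ ∈ {σ,σ̄}^n. Then (2b^n · L2(R_{b,n}^{Σ,sym}))^2 = n·c_b^σ + 11/8 + 1/b^n + (1 − 9·(−1)^b)/(144·b^{2n}), where c_b^σ = 2Φ_b^{σ,(2)} + Φ̃_b^σ + (1/2)Φ̃_{b,1}^σ + (1/2)Φ̃_{b,2}^σ. -/
open Finset
open scoped Classical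

noncomputable section

namespace SymHamm

/-- The reversal permutation `τ(k) = b−1−k` on `{0,…,b−1}`. -/
def tauP (b : ℕ) : Equiv.Perm (Fin b) := Fin.revPerm

/-- `σ̄ = τ ∘ σ`. -/
def pbar {b : ℕ} (σ : Equiv.Perm (Fin b)) : Equiv.Perm (Fin b) := σ.trans (tauP b)

/-- Value of a permutation of `Fin b` on a natural number. -/
def permVal {b : ℕ} (σ : Equiv.Perm (Fin b)) (k : ℕ) : ℕ :=
  if h : k < b then (σ ⟨k, h⟩ : ℕ) else 0

/-- Faure's function `φ_{b,h}^σ`, extended with period 1 to all of `ℝ`.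
For `x ∈ [(k−1)/b, k/b)` (i.e. `k−1 = ⌊b·{x}⌋`), it equals
`A([0,h/b);k;Z_b^σ) − h·x` if `h ≤ σ(k−1)` and `(b−h)·x − A([h/b,1);k;Z_b^σ)` otherwise,
where `A` counts the first `k` entries `σ(0)/b,…,σ(k−1)/b` of `Z_b^σ` in the interval. -/
def phi {b : ℕ} (σ : Equiv.Perm (Fin b)) (h : ℕ) (x : ℝ) : ℝ :=
  if h ≤ permVal σ (⌊(b : ℝ) * Int.fract x⌋).toNat then
    (((Finset.range ((⌊(b : ℝ) * Int.fract x⌋).toNat + 1)).filter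
        (fun l => permVal σ l < h)).card : ℝ) - (h : ℝ) * Int.fract x
  else
    ((b : ℝ) - (h : ℝ)) * Int.fract x -
      (((Finset.range ((⌊(b : ℝ) * Int.fract x⌋).toNat + 1)).filter
        (fun l => h ≤ permVal σ l)).card : ℝ)

/-- `φ_b^σ = ∑_{h=0}^{b−1} φ_{b,h}^σ`. -/
def phiS {b : ℕ} (σ : Equiv.Perm (Fin b)) (x : ℝ) : ℝ := ∑ h ∈ range b, phi σ h x

/-- `φ_b^{σ,(2)} = ∑_{h=0}^{b−1} (φ_{b,h}^σ)²`. -/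
def phiS2 {b : ℕ} (σ : Equiv.Perm (Fin b)) (x : ℝ) : ℝ := ∑ h ∈ range b, (phi σ h x) ^ 2

/-- `φ̃_b^σ = ∑_{h=0}^{b−1} φ_{b,h}^σ · φ_{b,h}^{σ̄}`. -/
def phiT {b : ℕ} (σ : Equiv.Perm (Fin b)) (x : ℝ) : ℝ :=
  ∑ h ∈ range b, phi σ h x * phi (pbar σ) h x

/-- `φ̃_{b,1}^σ = ∑_{h=0}^{b−2} φ_{b,h+1}^σ · φ_{b,h}^{σ̄}`. -/
def phiT1 {b : ℕ} (σ : Equiv.Perm (Fin b)) (x : ℝ) : ℝ :=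
  ∑ h ∈ range (b - 1), phi σ (h + 1) x * phi (pbar σ) h x

/-- `φ̃_{b,2}^σ = ∑_{h=0}^{b−2} φ_{b,h}^σ · φ_{b,h+1}^{σ̄}`. -/
def phiT2 {b : ℕ} (σ : Equiv.Perm (Fin b)) (x : ℝ) : ℝ :=
  ∑ h ∈ range (b - 1), phi σ h x * phi (pbar σ) (h + 1) x

/-- `Φ_b^σ = (1/b)·∫_0^1 φ_b^σ`. -/
def PhiS {b : ℕ} (σ : Equiv.Perm (Fin b)) : ℝ := (1 / (b : ℝ)) * ∫ x in (0:ℝ)..1, phiS σ x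

/-- `Φ_b^{σ,(2)} = (1/b)·∫_0^1 φ_b^{σ,(2)}`. -/
def PhiS2 {b : ℕ} (σ : Equiv.Perm (Fin b)) : ℝ := (1 / (b : ℝ)) * ∫ x in (0:ℝ)..1, phiS2 σ x

/-- `Φ̃_b^σ = (1/b)·∫_0^1 φ̃_b^σ`. -/
def PhiT {b : ℕ} (σ : Equiv.Perm (Fin b)) : ℝ := (1 / (b : ℝ)) * ∫ x in (0:ℝ)..1, phiT σ x

/-- `Φ̃_{b,1}^σ = (1/b)·∫_0^1 φ̃_{b,1}^σ`. -/
def PhiT1 {b : ℕ} (σ : Equiv.Perm (Fin b)) : ℝ := (1 / (b : ℝ)) * ∫ x in (0:ℝ)..1, phiT1 σ x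

/-- `Φ̃_{b,2}^σ = (1/b)·∫_0^1 φ̃_{b,2}^σ`. -/
def PhiT2 {b : ℕ} (σ : Equiv.Perm (Fin b)) : ℝ := (1 / (b : ℝ)) * ∫ x in (0:ℝ)..1, phiT2 σ x

/-- `ν_j(N,Σ) = σ_j(N_j)·b^{n−j−1} + … + σ_{n−1}(N_{n−1})`, where `N_i` is the `i`-th
`b`-adic digit of `N`. -/
def nu (b n : ℕ) (S : Fin n → Equiv.Perm (Fin b)) (N j : ℕ) : ℕ :=
  ∑ i : Fin n,
    if j ≤ (i : ℕ) then permVal (S i) ((N / b ^ (i : ℕ)) % b) * b ^ (n - 1 - (i : ℕ)) else 0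

/-- `ε_j(λ,N,Σ)`, for `1 ≤ j ≤ n`: it is `0` when `λ = bⁿ` or `N = bⁿ`; it is the last digit
`λ_n = λ % b` when `j = n`; otherwise, with `Λ_{j−1} = λ % b^{n−j+1}` and `ν_j = ν_j(N,Σ)`,
it is `0` if `Λ_{j−1} ≤ ν_j`, it is `h` if `ν_j + (h−1)b^{n−j} < Λ_{j−1} ≤ ν_j + h·b^{n−j}`
for some `1 ≤ h < b`, and `0` if `ν_j + (b−1)b^{n−j} < Λ_{j−1} < b^{n−j+1}`. -/
def eps (b n : ℕ) (S : Fin n → Equiv.Perm (Fin b)) (lam N j : ℕ) : ℕ :=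
  if lam = b ^ n ∨ N = b ^ n then 0
  else if j = n then lam % b
  else if lam % b ^ (n - j + 1) ≤ nu b n S N j then 0
  else ((lam % b ^ (n - j + 1) - nu b n S N j - 1) / b ^ (n - j) + 1) % b

/-- The point of the digit-scrambled Hammersley point set `R_{b,n}^Σ` with digits `a`:
`(∑_{j=0}^{n−1} σ_j(a_j)/b^{n−j}, ∑_{j=0}^{n−1} a_j/b^{j+1})`. -/
def hammPt (b n : ℕ) (S : Fin n → Equiv.Perm (Fin b)) (a : Fin n → Fin b) : ℝ × ℝ :=
  (∑ j : Fin n, ((S j (a j) : ℕ) : ℝ) / (b : ℝ) ^ (n - (j : ℕ)),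
   ∑ j : Fin n, ((a j : ℕ) : ℝ) / (b : ℝ) ^ ((j : ℕ) + 1))

/-- The symmetrized Hammersley point set `R_{b,n}^{Σ,sym} = R_{b,n}^Σ ∪ R_{b,n}^{Σ*}`,
a family of `2·bⁿ` points. -/
def symFam (b n : ℕ) (S : Fin n → Equiv.Perm (Fin b)) :
    Bool × (Fin n → Fin b) → ℝ × ℝ :=
  fun p => if p.1 then hammPt b n S p.2 else hammPt b n (fun i => pbar (S i)) p.2

/-- Local discrepancy `E(x,y,P) = #{i : P i ∈ [0,x)×[0,y)} − N·x·y` of a finite family of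
points, where `N` is the number of points. -/
def localDisc {ι : Type} [Fintype ι] (P : ι → ℝ × ℝ) (x y : ℝ) : ℝ :=
  ((Finset.univ.filter
      (fun i => 0 ≤ (P i).1 ∧ (P i).1 < x ∧ 0 ≤ (P i).2 ∧ (P i).2 < y)).card : ℝ)
    - (Fintype.card ι : ℝ) * x * y

/-- `L_2` discrepancy `L2(P) = (1/N)·(∫_0^1∫_0^1 E(x,y,P)² dx dy)^{1/2}`. -/
def L2disc {ι : Type} [Fintype ι] (P : ι → ℝ × ℝ) : ℝ :=
  (1 / (Fintype.card ι : ℝ)) *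
    Real.sqrt (∫ x in (0:ℝ)..1, ∫ y in (0:ℝ)..1, (localDisc P x y) ^ 2)

/-- The values of `u` are exactly the points `0, 1, …, N-1` shifted to be centered at `0`. -/
def IsGrid {ι : Type} [Fintype ι] (N : ℕ) (u : ι → ℝ) : Prop :=
  ∃ e : ι ≃ Fin N, ∀ i, u i = ((e i : ℕ) : ℝ) - ((N : ℝ) - 1) / 2

lemma sum_abs_sub_of_le (k m : ℕ) (h : m ≤ k) :
    ∑ l ∈ range m, |(k : ℝ) - l| = m * k - m * ((m : ℝ) - 1) / 2 := by
  induction m with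
  | zero => simp
  | succ m ih =>
    have hm : (m : ℝ) ≤ k := by exact_mod_cast (by omega : m ≤ k)
    rw [sum_range_succ, ih (by omega), abs_of_nonneg (by linarith)]
    push_cast; ring

lemma sum_abs_sub_add (k j : ℕ) :
    ∑ l ∈ range (k + j), |(k : ℝ) - l| = k * ((k : ℝ) + 1) / 2 + j * ((j : ℝ) - 1) / 2 := by
  induction j with
  | zero => rw [add_zero, sum_abs_sub_of_le k k le_rfl]; push_cast; ring
  | succ j ih =>
    have hj : (0 : ℝ) ≤ j := j.cast_nonneg
    rw [← add_assoc, sum_range_succ, ih, abs_of_nonpos (by push_cast; linarith)]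
    push_cast; ring

lemma sum_sign_sub_of_le (k m : ℕ) (h : m ≤ k) :
    ∑ l ∈ range m, Real.sign ((k : ℝ) - l) = m := by
  induction m with
  | zero => simp
  | succ m ih =>
    have hm : (m : ℝ) < k := by exact_mod_cast h
    rw [sum_range_succ, ih (by omega), Real.sign_of_pos (by linarith)]
    push_cast; ring

lemma sum_sign_sub_add (k j : ℕ) :
    ∑ l ∈ range (k + 1 + j), Real.sign ((k : ℝ) - l) = (k : ℝ) - j := by
  induction j with
  | zero => rw [add_zero, sum_range_succ, sum_sign_sub_of_le k k le_rfl]; simp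
  | succ j ih =>
    have hj : (0 : ℝ) ≤ j := j.cast_nonneg
    rw [← add_assoc, sum_range_succ, ih, Real.sign_of_neg (by push_cast; linarith)]
    push_cast; ring

lemma sum_abs_centered (N : ℕ) :
    ∑ k ∈ range N, |(k : ℝ) - ((N : ℝ) - 1) / 2| = ((N : ℝ) ^ 2 - (1 - (-1) ^ N) / 2) / 4 := by
  induction N using Nat.twoStepInduction with
  | zero => simp
  | one => simp
  | more N ih _ =>
    have hN : (0 : ℝ) ≤ N := N.cast_nonneg
    have h1 : ∀ k : ℕ, ((k + 1 : ℕ) : ℝ) - (((N + 2 : ℕ) : ℝ) - 1) / 2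
        = (k : ℝ) - ((N : ℝ) - 1) / 2 := fun k => by push_cast; ring
    rw [sum_range_succ', sum_range_succ]
    simp only [h1]
    rw [ih, abs_of_nonneg (by linarith), abs_of_nonpos (by push_cast; linarith)]
    push_cast; ring

lemma sum_sq_centered (N : ℕ) :
    ∑ k ∈ range N, ((k : ℝ) - ((N : ℝ) - 1) / 2) ^ 2 = N * ((N : ℝ) ^ 2 - 1) / 12 := by
  have h : ∀ c : ℝ, ∑ k ∈ range N, ((k : ℝ) - c) ^ 2
      = N * ((N : ℝ) - 1) * (2 * N - 1) / 6 - c * (N * ((N : ℝ) - 1)) + N * c ^ 2 := by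
    intro c
    induction N with
    | zero => simp
    | succ N ih => rw [sum_range_succ, ih]; push_cast; ring
  rw [h]; ring

lemma sum_centered (N : ℕ) : ∑ k ∈ range N, ((k : ℝ) - ((N : ℝ) - 1) / 2) = 0 := by
  have h : ∀ c : ℝ, ∑ k ∈ range N, ((k : ℝ) - c) = N * ((N : ℝ) - 1) / 2 - N * c := by
    intro c
    induction N with
    | zero => simp
    | succ N ih => rw [sum_range_succ, ih]; push_cast; ring
  rw [h]; ring

namespace IsGrid

variable {ι : Type} [Fintype ι] {N : ℕ} {u : ι → ℝ}

lemma sum_comp (h : IsGrid N u) (f : ℝ → ℝ) :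
    ∑ i, f (u i) = ∑ k ∈ range N, f ((k : ℝ) - ((N : ℝ) - 1) / 2) := by
  obtain ⟨e, he⟩ := h
  simp only [he]
  rw [Equiv.sum_comp e (fun k : Fin N => f (((k : ℕ) : ℝ) - ((N : ℝ) - 1) / 2)),
    Fin.sum_univ_eq_sum_range (fun k : ℕ => f ((k : ℝ) - ((N : ℝ) - 1) / 2))]

lemma injective (h : IsGrid N u) : Function.Injective u := by
  obtain ⟨e, he⟩ := h
  intro i j hij
  rw [he, he] at hij
  apply e.injective
  apply Fin.ext
  have : ((e i : ℕ) : ℝ) = (e j : ℕ) := by linarith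
  exact_mod_cast this

lemma card (h : IsGrid N u) : Fintype.card ι = N := by
  obtain ⟨e, -⟩ := h
  simpa using Fintype.card_congr e

lemma exists_nat (h : IsGrid N u) (i : ι) :
    ∃ k j : ℕ, k + 1 + j = N ∧ u i = (k : ℝ) - ((N : ℝ) - 1) / 2 := by
  obtain ⟨e, he⟩ := h
  exact ⟨e i, N - 1 - e i, by have := (e i).2; omega, he i⟩

lemma sum_eq_zero (h : IsGrid N u) : ∑ i, u i = 0 := by
  rw [h.sum_comp (fun x => x), sum_centered]

lemma sum_sq (h : IsGrid N u) : ∑ i, u i ^ 2 = N * ((N : ℝ) ^ 2 - 1) / 12 := by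
  rw [h.sum_comp (fun x => x ^ 2), sum_sq_centered]

lemma sum_abs (h : IsGrid N u) :
    ∑ i, |u i| = ((N : ℝ) ^ 2 - (1 - (-1) ^ N) / 2) / 4 := by
  rw [h.sum_comp (fun x => |x|), sum_abs_centered]

lemma sum_abs_sub (h : IsGrid N u) (i : ι) :
    ∑ j, |u i - u j| = u i ^ 2 + ((N : ℝ) ^ 2 - 1) / 4 := by
  obtain ⟨k, j, hkj, hk⟩ := h.exists_nat i
  rw [h.sum_comp (fun x => |u i - x|), hk]
  simp only [sub_sub_sub_cancel_right]
  have := sum_abs_sub_add k (1 + j)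
  rw [← add_assoc, hkj] at this
  rw [this, ← hkj]
  push_cast; ring

lemma sum_sign_sub (h : IsGrid N u) (i : ι) : ∑ j, Real.sign (u i - u j) = 2 * u i := by
  obtain ⟨k, j, hkj, hk⟩ := h.exists_nat i
  rw [h.sum_comp (fun x => Real.sign (u i - x)), hk]
  simp only [sub_sub_sub_cancel_right]
  have := sum_sign_sub_add k j
  rw [hkj] at this
  rw [this, ← hkj]
  push_cast; ring

lemma neg (h : IsGrid N u) : IsGrid N (fun i => -u i) := by
  obtain ⟨e, he⟩ := h
  refine ⟨e.trans Fin.revPerm, fun i => ?_⟩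
  have : (e i : ℕ) + 1 ≤ N := (e i).2
  simp only [he, Equiv.trans_apply, Fin.revPerm_apply, Fin.val_rev]
  push_cast [Nat.cast_sub this]
  ring

lemma sum_comp_neg (h : IsGrid N u) (f : ℝ → ℝ) : ∑ i, f (-u i) = ∑ i, f (u i) := by
  rw [h.sum_comp f, h.neg.sum_comp f]

lemma sum_abs_add (h : IsGrid N u) (i : ι) :
    ∑ j, |u i + u j| = u i ^ 2 + ((N : ℝ) ^ 2 - 1) / 4 := by
  rw [← h.sum_abs_sub i, ← h.sum_comp_neg (fun x => |u i - x|)]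
  simp

lemma sum_sign_add (h : IsGrid N u) (i : ι) : ∑ j, Real.sign (u i + u j) = 2 * u i := by
  rw [← h.sum_sign_sub i, ← h.sum_comp_neg (fun x => Real.sign (u i - x))]
  simp

lemma sum_sum_abs_sub (h : IsGrid N u) :
    ∑ i, ∑ j, |u i - u j| = N * ((N : ℝ) ^ 2 - 1) / 3 := by
  simp only [h.sum_abs_sub, sum_add_distrib, h.sum_sq, sum_const, card_univ, h.card, nsmul_eq_mul]
  ring

lemma sum_sum_abs_add (h : IsGrid N u) :
    ∑ i, ∑ j, |u i + u j| = N * ((N : ℝ) ^ 2 - 1) / 3 := by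
  simp only [h.sum_abs_add, sum_add_distrib, h.sum_sq, sum_const, card_univ, h.card, nsmul_eq_mul]
  ring

lemma sub_eq_int (h : IsGrid N u) (i j : ι) : ∃ z : ℤ, u i - u j = z ∧ |z| < N := by
  obtain ⟨e, he⟩ := h
  refine ⟨(e i : ℤ) - (e j : ℤ), by rw [he, he]; push_cast; ring, ?_⟩
  have := (e i).2
  have := (e j).2
  rw [abs_lt]; constructor <;> omega

lemma add_eq_int (h : IsGrid N u) (i j : ι) : ∃ z : ℤ, u i + u j = z ∧ |z| < N := by
  obtain ⟨e, he⟩ := h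
  have := (e i).2
  have := (e j).2
  refine ⟨(e i : ℤ) + (e j : ℤ) - ((N : ℤ) - 1), by rw [he, he]; push_cast; ring, ?_⟩
  rw [abs_lt]; constructor <;> omega

lemma abs_sub_le (h : IsGrid N u) (i j : ι) : |u i - u j| ≤ N := by
  obtain ⟨z, hz, hz'⟩ := h.sub_eq_int i j
  rw [hz]; exact_mod_cast hz'.le

lemma abs_add_le (h : IsGrid N u) (i j : ι) : |u i + u j| ≤ N := by
  obtain ⟨z, hz, hz'⟩ := h.add_eq_int i j
  rw [hz]; exact_mod_cast hz'.le

lemma prod {κ : Type} [Fintype κ] {b : ℕ} {α : κ → ℝ} (hα : IsGrid b α) (hu : IsGrid N u) :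
    IsGrid (b * N) (fun p : κ × ι => b * u p.2 + α p.1) := by
  obtain ⟨e, he⟩ := hu
  obtain ⟨d, hd⟩ := hα
  refine ⟨(Equiv.prodComm κ ι).trans ((e.prodCongr d).trans
    (finProdFinEquiv.trans (finCongr (Nat.mul_comm N b)))), fun p => ?_⟩
  simp [he, hd, finProdFinEquiv]
  ring

lemma prod_swap {κ : Type} [Fintype κ] {b : ℕ} {α : κ → ℝ} (hα : IsGrid b α) (hu : IsGrid N u) :
    IsGrid (b * N) (fun p : κ × ι => u p.2 + N * α p.1) := by
  obtain ⟨e, he⟩ := hu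
  obtain ⟨d, hd⟩ := hα
  refine ⟨(d.prodCongr e).trans finProdFinEquiv, fun p => ?_⟩
  simp [he, hd, finProdFinEquiv]
  ring

end IsGrid

/-- The indicator of `0`. -/
def zeroInd (x : ℝ) : ℝ := if x = 0 then 1 else 0

lemma zeroInd_neg (x : ℝ) : zeroInd (-x) = zeroInd x := by simp [zeroInd]

lemma abs_mul_int_add {c : ℝ} {z : ℤ} {w : ℝ} (hw : |w| ≤ c) :
    |c * z + w| = c * |(z : ℝ)| + Real.sign z * w + zeroInd z * |w| := by
  obtain ⟨h1, h2⟩ := abs_le.mp hw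
  have hc : 0 ≤ c := (abs_nonneg w).trans hw
  rcases lt_trichotomy z 0 with h | h | h
  · have hz : (z : ℝ) ≤ -1 := by exact_mod_cast (by omega : z ≤ -1)
    have hz0 : (z : ℝ) < 0 := by linarith
    rw [Real.sign_of_neg hz0, zeroInd, if_neg hz0.ne, abs_of_neg hz0,
      abs_of_nonpos (by nlinarith)]
    ring
  · subst h; simp [zeroInd]
  · have hz : (1 : ℝ) ≤ z := by exact_mod_cast h
    have hz0 : (0 : ℝ) < z := by linarith
    rw [Real.sign_of_pos hz0, zeroInd, if_neg hz0.ne', abs_of_pos hz0,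
      abs_of_nonneg (by nlinarith)]
    ring

section Product

variable {ι κ : Type} [Fintype ι] [Fintype κ]

lemma sum_pair_mul (F : ι → ι → ℝ) (G : κ → κ → ℝ) :
    ∑ p : κ × ι, ∑ q : κ × ι, F p.2 q.2 * G p.1 q.1
      = (∑ i, ∑ j, F i j) * ∑ a, ∑ c, G a c := by
  simp only [Fintype.sum_prod_type]
  rw [mul_comm, sum_mul_sum]
  refine sum_congr rfl fun a _ => sum_congr rfl fun i _ => ?_
  rw [sum_mul_sum]
  exact sum_congr rfl fun c _ => sum_congr rfl fun j _ => mul_comm _ _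

lemma sum_pair_abs_mul_abs (b N : ℝ) (x y : ι → ι → ℝ) (d e : κ → κ → ℝ)
    (hx : ∀ i j, ∃ z : ℤ, x i j = z) (he : ∀ a c, ∃ z : ℤ, e a c = z)
    (hd : ∀ a c, |d a c| ≤ b) (hy : ∀ i j, |y i j| ≤ N) :
    ∑ p : κ × ι, ∑ q : κ × ι,
        |b * x p.2 q.2 + d p.1 q.1| * |y p.2 q.2 + N * e p.1 q.1|
      = b * N * ((∑ i, ∑ j, |x i j|) * ∑ a, ∑ c, |e a c|)
        + b * ((∑ i, ∑ j, |x i j| * y i j) * ∑ a, ∑ c, Real.sign (e a c))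
        + b * ((∑ i, ∑ j, |x i j| * |y i j|) * ∑ a, ∑ c, zeroInd (e a c))
        + N * ((∑ i, ∑ j, Real.sign (x i j)) * ∑ a, ∑ c, d a c * |e a c|)
        + (∑ i, ∑ j, Real.sign (x i j) * y i j) * (∑ a, ∑ c, d a c * Real.sign (e a c))
        + (∑ i, ∑ j, Real.sign (x i j) * |y i j|) * (∑ a, ∑ c, d a c * zeroInd (e a c))
        + N * ((∑ i, ∑ j, zeroInd (x i j)) * ∑ a, ∑ c, |d a c| * |e a c|)
        + (∑ i, ∑ j, zeroInd (x i j) * y i j) * (∑ a, ∑ c, |d a c| * Real.sign (e a c))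
        + (∑ i, ∑ j, zeroInd (x i j) * |y i j|) * (∑ a, ∑ c, |d a c| * zeroInd (e a c)) := by
  simp only [← sum_pair_mul]
  simp only [mul_sum, ← sum_add_distrib]
  refine sum_congr rfl fun p _ => sum_congr rfl fun q _ => ?_
  obtain ⟨z, hz⟩ := hx p.2 q.2
  obtain ⟨w, hw⟩ := he p.1 q.1
  rw [hz, hw, abs_mul_int_add (hd _ _), add_comm (y p.2 q.2), abs_mul_int_add (hy _ _)]
  ring

/-- A finite point set with coordinates `u`, `v`, each coordinate being a centered grid,
which is invariant under the reflection `r` at the origin. -/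
structure IsSymGrid (N : ℕ) (u v : ι → ℝ) (r : ι → ι) : Prop where
  grid_fst : IsGrid N u
  grid_snd : IsGrid N v
  fst_refl : ∀ i, u (r i) = -u i
  snd_refl : ∀ i, v (r i) = -v i

/-- `∑ |u_i - u_j| |v_i - v_j|`. -/
def pairDiff (u v : ι → ℝ) : ℝ := ∑ i, ∑ j, |u i - u j| * |v i - v j|

/-- `∑ |u_i + u_j| |v_i - v_j|`. -/
def pairSum (u v : ι → ℝ) : ℝ := ∑ i, ∑ j, |u i + u j| * |v i - v j|

/-- `∑ u_i² v_i²`. -/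
def sqMoment (u v : ι → ℝ) : ℝ := ∑ i, u i ^ 2 * v i ^ 2

lemma sum_sum_eq_zero_of_antisymm {F : ι → ι → ℝ} (h : ∀ i j, F j i = -F i j) :
    ∑ i, ∑ j, F i j = 0 := by
  have h1 : ∑ i, ∑ j, F i j = -∑ i, ∑ j, F i j := by
    conv_lhs => rw [sum_comm]
    simp only [← sum_neg_distrib]
    exact sum_congr rfl fun i _ => sum_congr rfl fun j _ => h i j
  linarith

lemma sum_zeroInd_sub_mul {u : ι → ℝ} (hu : Function.Injective u) (F : ι → ι → ℝ) :
    ∑ i, ∑ j, zeroInd (u i - u j) * F i j = ∑ i, F i i := by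
  refine sum_congr rfl fun i _ => ?_
  simp [zeroInd, sub_eq_zero, hu.eq_iff]

namespace IsSymGrid

variable {N b : ℕ} {u v : ι → ℝ} {r : ι → ι} {α β : κ → ℝ} {s : κ → κ}

lemma refl_bijective (h : IsSymGrid N u v r) : Function.Bijective r := by
  apply Function.Involutive.bijective
  intro i
  apply h.grid_fst.injective
  rw [h.fst_refl, h.fst_refl, neg_neg]

lemma sum_eq_zero_of_odd (h : IsSymGrid N u v r) (f : ℝ → ℝ → ℝ)
    (hf : ∀ x y, f (-x) (-y) = -f x y) : ∑ i, f (u i) (v i) = 0 := by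
  have h1 := h.refl_bijective.sum_comp (fun i => f (u i) (v i))
  simp only [h.fst_refl, h.snd_refl, hf, sum_neg_distrib] at h1
  linarith

lemma sum_zeroInd_add_mul (h : IsSymGrid N u v r) (F : ι → ι → ℝ) :
    ∑ i, ∑ j, zeroInd (u i + u j) * F i j = ∑ i, F i (r i) := by
  refine sum_congr rfl fun i _ => ?_
  have : ∀ j, u i + u j = 0 ↔ r i = j := fun j => by
    rw [← h.grid_fst.injective.eq_iff, h.fst_refl]
    constructor <;> intro h <;> linarith
  simp [zeroInd, this]

lemma prod (hα : IsSymGrid b α β s) (hu : IsSymGrid N u v r) :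
    IsSymGrid (b * N) (fun p : κ × ι => b * u p.2 + α p.1)
      (fun p : κ × ι => v p.2 + N * β p.1) (Prod.map s r) where
  grid_fst := hα.grid_fst.prod hu.grid_fst
  grid_snd := hα.grid_snd.prod_swap hu.grid_snd
  fst_refl p := by simp only [Prod.map_fst, Prod.map_snd, hu.fst_refl, hα.fst_refl]; ring
  snd_refl p := by simp only [Prod.map_fst, Prod.map_snd, hu.snd_refl, hα.snd_refl]; ring

lemma sum_sign_sub_mul_sub (h : IsSymGrid N u v r) :
    ∑ i, ∑ j, Real.sign (u i - u j) * (v i - v j) = 4 * ∑ i, u i * v i := by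
  have h1 : ∑ i, ∑ j, Real.sign (u i - u j) * v i = 2 * ∑ i, u i * v i := by
    simp only [← sum_mul, h.grid_fst.sum_sign_sub, mul_sum, mul_assoc]
  have h2 : ∑ i, ∑ j, Real.sign (u i - u j) * v j = -(2 * ∑ i, u i * v i) := by
    rw [sum_comm, ← h1]
    simp only [← sum_neg_distrib]
    refine sum_congr rfl fun i _ => sum_congr rfl fun j _ => ?_
    rw [← neg_sub (u i), Real.sign_neg]; ring
  simp only [mul_sub, sum_sub_distrib, h1, h2]
  ring

lemma swap (h : IsSymGrid N u v r) : IsSymGrid N v u r :=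
  ⟨h.grid_snd, h.grid_fst, h.snd_refl, h.fst_refl⟩

lemma pairDiff_prod (hα : IsSymGrid b α β s) (hu : IsSymGrid N u v r) :
    pairDiff (fun p : κ × ι => b * u p.2 + α p.1) (fun p : κ × ι => v p.2 + N * β p.1)
      = b ^ 2 * pairDiff u v + N ^ 2 * pairDiff α β
        + b * N * (N * ((N : ℝ) ^ 2 - 1) / 3) * (b * ((b : ℝ) ^ 2 - 1) / 3)
        + 16 * (∑ i, u i * v i) * ∑ a, α a * β a := by
  have key := sum_pair_abs_mul_abs (b : ℝ) (N : ℝ) (fun i j => u i - u j) (fun i j => v i - v j)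
    (fun a c => α a - α c) (fun a c => β a - β c)
    (fun i j => (hu.grid_fst.sub_eq_int i j).imp fun _ h => h.1)
    (fun i j => (hα.grid_snd.sub_eq_int i j).imp fun _ h => h.1)
    hα.grid_fst.abs_sub_le hu.grid_snd.abs_sub_le
  have e1 : ∑ a, ∑ c, Real.sign (β a - β c) = 0 := by
    simp only [hα.grid_snd.sum_sign_sub, ← mul_sum, hα.grid_snd.sum_eq_zero, mul_zero]
  have e2 : ∑ a, ∑ c, zeroInd (β a - β c) = b := by
    have := sum_zeroInd_sub_mul hα.grid_snd.injective (fun _ _ => 1)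
    simpa [hα.grid_fst.card] using this
  have e3 : ∑ i, ∑ j, Real.sign (u i - u j) = 0 := by
    simp only [hu.grid_fst.sum_sign_sub, ← mul_sum, hu.grid_fst.sum_eq_zero, mul_zero]
  have e4 : ∑ a, ∑ c, (α a - α c) * zeroInd (β a - β c) = 0 := by
    simp only [mul_comm _ (zeroInd _), sum_zeroInd_sub_mul hα.grid_snd.injective, sub_self,
      sum_const_zero]
  have e5 : ∑ i, ∑ j, zeroInd (u i - u j) = N := by
    have := sum_zeroInd_sub_mul hu.grid_fst.injective (fun _ _ => 1)
    simpa [hu.grid_fst.card] using this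
  have e6 : ∑ a, ∑ c, (α a - α c) * Real.sign (β a - β c) = 4 * ∑ a, α a * β a := by
    simp only [mul_comm _ (Real.sign _), hα.swap.sum_sign_sub_mul_sub]
    simp only [mul_comm]
  have e7 := sum_zeroInd_sub_mul hu.grid_fst.injective (fun i j => v i - v j)
  have e8 := sum_zeroInd_sub_mul hu.grid_fst.injective (fun i j => |v i - v j|)
  simp only [sub_self, abs_zero, sum_const_zero] at e7 e8
  rw [e1, e2, e3, e4, e5, e6, e7, e8, hu.sum_sign_sub_mul_sub, hu.grid_fst.sum_sum_abs_sub,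
    hα.grid_snd.sum_sum_abs_sub] at key
  calc _ = _ := by
        refine sum_congr rfl fun p _ => sum_congr rfl fun q _ => ?_
        congr 2 <;> ring
    _ = _ := key
    _ = _ := by rw [pairDiff, pairDiff]; ring

lemma pairSum_prod (hα : IsSymGrid b α β s) (hu : IsSymGrid N u v r) :
    pairSum (fun p : κ × ι => b * u p.2 + α p.1) (fun p : κ × ι => v p.2 + N * β p.1)
      = b ^ 2 * pairSum u v + N ^ 2 * pairSum α β
        + b * N * (N * ((N : ℝ) ^ 2 - 1) / 3) * (b * ((b : ℝ) ^ 2 - 1) / 3)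
        + 4 * (∑ i, |v i|) * ∑ a, |α a| := by
  have key := sum_pair_abs_mul_abs (b : ℝ) (N : ℝ) (fun i j => u i + u j) (fun i j => v i - v j)
    (fun a c => α a + α c) (fun a c => β a - β c)
    (fun i j => (hu.grid_fst.add_eq_int i j).imp fun _ h => h.1)
    (fun i j => (hα.grid_snd.sub_eq_int i j).imp fun _ h => h.1)
    hα.grid_fst.abs_add_le hu.grid_snd.abs_sub_le
  have e1 : ∑ a, ∑ c, Real.sign (β a - β c) = 0 := by
    simp only [hα.grid_snd.sum_sign_sub, ← mul_sum, hα.grid_snd.sum_eq_zero, mul_zero]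
  have e2 : ∑ a, ∑ c, zeroInd (β a - β c) = b := by
    have := sum_zeroInd_sub_mul hα.grid_snd.injective (fun _ _ => 1)
    simpa [hα.grid_fst.card] using this
  have e3 : ∑ i, ∑ j, Real.sign (u i + u j) = 0 := by
    simp only [hu.grid_fst.sum_sign_add, ← mul_sum, hu.grid_fst.sum_eq_zero, mul_zero]
  have e4 : ∑ a, ∑ c, (α a + α c) * zeroInd (β a - β c) = 0 := by
    simp only [mul_comm _ (zeroInd _), sum_zeroInd_sub_mul hα.grid_snd.injective,
      sum_add_distrib, hα.grid_fst.sum_eq_zero, add_zero]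
  have e5 : ∑ i, ∑ j, zeroInd (u i + u j) = N := by
    have := hu.sum_zeroInd_add_mul (fun _ _ => 1)
    simpa [hu.grid_fst.card] using this
  have e6 : ∑ a, ∑ c, (α a + α c) * Real.sign (β a - β c) = 0 :=
    sum_sum_eq_zero_of_antisymm fun a c => by rw [← neg_sub, Real.sign_neg]; ring
  have e7 : ∑ a, ∑ c, |α a + α c| * Real.sign (β a - β c) = 0 :=
    sum_sum_eq_zero_of_antisymm fun a c => by rw [← neg_sub, Real.sign_neg, add_comm]; ring
  have e8 : ∑ i, ∑ j, zeroInd (u i + u j) * |v i - v j| = 2 * ∑ i, |v i| := by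
    rw [hu.sum_zeroInd_add_mul (fun i j => |v i - v j|), mul_sum]
    refine sum_congr rfl fun i _ => ?_
    rw [hu.snd_refl, sub_neg_eq_add, ← two_mul, abs_mul, abs_two]
  have e9 : ∑ a, ∑ c, |α a + α c| * zeroInd (β a - β c) = 2 * ∑ a, |α a| := by
    simp only [mul_comm _ (zeroInd _), sum_zeroInd_sub_mul hα.grid_snd.injective, mul_sum]
    refine sum_congr rfl fun i _ => ?_
    rw [← two_mul, abs_mul, abs_two]
  rw [e1, e2, e3, e4, e5, e6, e7, e8, e9, hu.grid_fst.sum_sum_abs_add,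
    hα.grid_snd.sum_sum_abs_sub] at key
  calc _ = _ := by
        refine sum_congr rfl fun p _ => sum_congr rfl fun q _ => ?_
        congr 2 <;> ring
    _ = _ := key
    _ = _ := by rw [pairSum, pairSum]; ring

lemma sqMoment_prod (hα : IsSymGrid b α β s) (hu : IsSymGrid N u v r) :
    sqMoment (fun p : κ × ι => b * u p.2 + α p.1) (fun p : κ × ι => v p.2 + N * β p.1)
      = b ^ 3 * sqMoment u v + N ^ 3 * sqMoment α β
        + (b ^ 2 * N ^ 2 + 1) * (N * ((N : ℝ) ^ 2 - 1) / 12) * (b * ((b : ℝ) ^ 2 - 1) / 12)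
        + 4 * b * N * (∑ i, u i * v i) * ∑ a, α a * β a := by
  have hsep : ∀ (f : κ → ℝ) (g : ι → ℝ), ∑ p : κ × ι, f p.1 * g p.2 = (∑ a, f a) * ∑ i, g i := by
    intro f g
    rw [Fintype.sum_prod_type, sum_mul_sum]
  have expand : sqMoment (fun p : κ × ι => b * u p.2 + α p.1)
      (fun p : κ × ι => v p.2 + N * β p.1)
      = b ^ 2 * ((∑ _a : κ, (1 : ℝ)) * ∑ i, u i ^ 2 * v i ^ 2)
        + 2 * b ^ 2 * N * ((∑ a, β a) * ∑ i, u i ^ 2 * v i)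
        + b ^ 2 * N ^ 2 * ((∑ a, β a ^ 2) * ∑ i, u i ^ 2)
        + 2 * b * ((∑ a, α a) * ∑ i, u i * v i ^ 2)
        + 4 * b * N * ((∑ a, α a * β a) * ∑ i, u i * v i)
        + 2 * b * N ^ 2 * ((∑ a, α a * β a ^ 2) * ∑ i, u i)
        + (∑ a, α a ^ 2) * (∑ i, v i ^ 2)
        + 2 * N * ((∑ a, α a ^ 2 * β a) * ∑ i, v i)
        + N ^ 2 * ((∑ a, α a ^ 2 * β a ^ 2) * ∑ _i : ι, (1 : ℝ)) := by
    simp only [← hsep]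
    simp only [mul_sum, ← sum_add_distrib, sqMoment]
    exact sum_congr rfl fun p _ => by ring
  rw [expand, hα.grid_fst.sum_eq_zero, hα.grid_snd.sum_eq_zero, hu.grid_fst.sum_eq_zero,
    hu.grid_snd.sum_eq_zero, hα.grid_fst.sum_sq, hα.grid_snd.sum_sq, hu.grid_fst.sum_sq,
    hu.grid_snd.sum_sq, sqMoment, sqMoment]
  simp only [sum_const, card_univ, hα.grid_fst.card, hu.grid_fst.card, nsmul_eq_mul]
  ring

end IsSymGrid

end Product

section Energy

variable {ι ι' : Type} [Fintype ι] [Fintype ι']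

lemma IsGrid.of_equiv {N : ℕ} {u : ι' → ℝ} (e : ι ≃ ι') (h : IsGrid N (fun i => u (e i))) :
    IsGrid N u := by
  obtain ⟨d, hd⟩ := h
  exact ⟨e.symm.trans d, fun i => by simpa using hd (e.symm i)⟩

/-- The part of the squared `L_2` discrepancy of a symmetrized set of `2N` points that is not
determined by the coordinate projections of the point set. -/
def energy (N : ℝ) (u v : ι → ℝ) : ℝ :=
  (pairDiff u v + pairSum u v) / (2 * N ^ 2) - 2 * sqMoment u v / N ^ 3

lemma energy_comp_equiv (N : ℝ) (u v : ι' → ℝ) (e : ι ≃ ι') :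
    energy N (fun i => u (e i)) (fun i => v (e i)) = energy N u v := by
  have hd : pairDiff (fun i => u (e i)) (fun i => v (e i)) = pairDiff u v := by
    rw [pairDiff, pairDiff, ← Equiv.sum_comp e]
    exact sum_congr rfl fun i _ => Equiv.sum_comp e (fun j => |u (e i) - u j| * |v (e i) - v j|)
  have hs : pairSum (fun i => u (e i)) (fun i => v (e i)) = pairSum u v := by
    rw [pairSum, pairSum, ← Equiv.sum_comp e]
    exact sum_congr rfl fun i _ => Equiv.sum_comp e (fun j => |u (e i) + u j| * |v (e i) - v j|)
  have hq : sqMoment (fun i => u (e i)) (fun i => v (e i)) = sqMoment u v :=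
    Equiv.sum_comp e (fun i => u i ^ 2 * v i ^ 2)
  rw [energy, energy, hd, hs, hq]

lemma energy_neg (N : ℝ) (u v : ι → ℝ) : energy N (fun i => -u i) v = energy N u v := by
  have hd : pairDiff (fun i => -u i) v = pairDiff u v := by
    refine sum_congr rfl fun i _ => sum_congr rfl fun j _ => ?_
    rw [neg_sub_neg, abs_sub_comm]
  have hs : pairSum (fun i => -u i) v = pairSum u v := by
    refine sum_congr rfl fun i _ => sum_congr rfl fun j _ => ?_
    rw [← neg_add, abs_neg]
  simp only [energy, hd, hs, sqMoment, neg_sq]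

lemma IsSymGrid.energy_prod {N b : ℕ} {u v : ι → ℝ} {r : ι → ι} {α β : ι' → ℝ} {s : ι' → ι'}
    (hα : IsSymGrid b α β s) (hu : IsSymGrid N u v r) (hb : b ≠ 0) (hN : N ≠ 0) :
    energy (b * N) (fun p : ι' × ι => b * u p.2 + α p.1) (fun p : ι' × ι => v p.2 + N * β p.1)
      = energy N u v + energy b α β + ((N : ℝ) ^ 2 - 1) * ((b : ℝ) ^ 2 - 1) / 9
        - ((b : ℝ) ^ 2 * N ^ 2 + 1) * ((N : ℝ) ^ 2 - 1) * ((b : ℝ) ^ 2 - 1) / (72 * b ^ 2 * N ^ 2)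
        + 2 * (∑ i, |v i|) * (∑ a, |α a|) / (b ^ 2 * N ^ 2) := by
  have hb' : (b : ℝ) ≠ 0 := by exact_mod_cast hb
  have hN' : (N : ℝ) ≠ 0 := by exact_mod_cast hN
  rw [energy, hα.pairDiff_prod hu, hα.pairSum_prod hu, hα.sqMoment_prod hu, energy, energy]
  field_simp
  ring

end Energy

section Digits

variable {b : ℕ}

/-- The digit `k` shifted by the mean of all digits. -/
def centered (k : Fin b) : ℝ := ((k : ℕ) : ℝ) - ((b : ℝ) - 1) / 2

lemma centered_rev (k : Fin b) : centered (Fin.rev k) = -centered k := by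
  have : (k : ℕ) + 1 ≤ b := k.2
  simp only [centered, Fin.val_rev]
  push_cast [Nat.cast_sub this]
  ring

lemma centered_pbar (σ : Equiv.Perm (Fin b)) (k : Fin b) :
    centered (pbar σ k) = -centered (σ k) := centered_rev _

lemma isGrid_centered_perm (σ : Equiv.Perm (Fin b)) : IsGrid b (fun k => centered (σ k)) :=
  ⟨σ, fun _ => rfl⟩

lemma isSymGrid_perm {σ : Equiv.Perm (Fin b)} (h : ∀ k, σ (Fin.rev k) = Fin.rev (σ k)) :
    IsSymGrid b (fun k => centered (σ k)) centered Fin.rev where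
  grid_fst := isGrid_centered_perm σ
  grid_snd := isGrid_centered_perm (Equiv.refl _)
  fst_refl k := by rw [h, centered_rev]
  snd_refl k := centered_rev k

/-- The first coordinate of a Hammersley point, scaled and centered. -/
def fstCoord {n : ℕ} (S : Fin n → Equiv.Perm (Fin b)) (a : Fin n → Fin b) : ℝ :=
  ∑ j : Fin n, centered (S j (a j)) * (b : ℝ) ^ (j : ℕ)

/-- The second coordinate of a Hammersley point, scaled and centered. -/
def sndCoord {n : ℕ} (a : Fin n → Fin b) : ℝ :=
  ∑ j : Fin n, centered (a j) * (b : ℝ) ^ (n - 1 - (j : ℕ))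

lemma fstCoord_cons {n : ℕ} (S : Fin (n + 1) → Equiv.Perm (Fin b)) (p : Fin b × (Fin n → Fin b)) :
    fstCoord S (Fin.consEquiv (fun _ => Fin b) p)
      = b * fstCoord (fun i => S i.succ) p.2 + centered (S 0 p.1) := by
  simp only [fstCoord, Fin.sum_univ_succ, Fin.consEquiv_apply, Fin.cons_zero, Fin.cons_succ,
    Fin.val_zero, Fin.val_succ, mul_sum, pow_succ]
  rw [add_comm]
  congr 1
  · exact sum_congr rfl fun i _ => by ring
  · ring

lemma sndCoord_cons {n : ℕ} (p : Fin b × (Fin n → Fin b)) :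
    sndCoord (Fin.consEquiv (fun _ => Fin b) p)
      = sndCoord p.2 + ((b ^ n : ℕ) : ℝ) * centered p.1 := by
  simp only [sndCoord, Fin.sum_univ_succ, Fin.consEquiv_apply, Fin.cons_zero, Fin.cons_succ,
    Fin.val_zero, Fin.val_succ]
  rw [add_comm]
  congr 1
  · refine sum_congr rfl fun i _ => ?_
    congr 2
    omega
  · push_cast
    rw [mul_comm]
    rfl

lemma isGrid_tuple {n : ℕ} (S : Fin n → Equiv.Perm (Fin b)) :
    IsGrid (b ^ n) (fstCoord S) ∧ IsGrid (b ^ n) (sndCoord : (Fin n → Fin b) → ℝ) := by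
  induction n with
  | zero =>
    have e : (Fin 0 → Fin b) ≃ Fin (b ^ 0) := Equiv.ofUnique (Fin 0 → Fin b) (Fin 1)
    have h0 : ∀ a, ((e a : ℕ) : ℝ) = 0 := fun a => by
      have := (e a).2
      exact_mod_cast Nat.lt_one_iff.mp (this.trans_eq (pow_zero b))
    exact ⟨⟨e, fun a => by rw [h0]; simp [fstCoord]⟩, ⟨e, fun a => by rw [h0]; simp [sndCoord]⟩⟩
  | succ n ih =>
    obtain ⟨h1, h2⟩ := ih (fun i => S i.succ)
    constructor
    · apply IsGrid.of_equiv (Fin.consEquiv (fun _ => Fin b))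
      simp only [fstCoord_cons]
      rw [pow_succ, mul_comm]
      exact (isGrid_centered_perm (S 0)).prod h1
    · apply IsGrid.of_equiv (Fin.consEquiv (fun _ => Fin b))
      simp only [sndCoord_cons]
      rw [pow_succ, mul_comm]
      have := (isGrid_centered_perm (Equiv.refl (Fin b))).prod_swap h2
      exact this

lemma isSymGrid_tuple {n : ℕ} {S : Fin n → Equiv.Perm (Fin b)}
    (h : ∀ i k, S i (Fin.rev k) = Fin.rev (S i k)) :
    IsSymGrid (b ^ n) (fstCoord S) sndCoord (fun a j => Fin.rev (a j)) where
  grid_fst := (isGrid_tuple S).1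
  grid_snd := (isGrid_tuple S).2
  fst_refl a := by simp only [fstCoord, h, centered_rev, neg_mul, sum_neg_distrib]
  snd_refl a := by simp only [sndCoord, centered_rev, neg_mul, sum_neg_distrib]

lemma neg_one_pow_pow (n : ℕ) (hn : n ≠ 0) : (-1 : ℝ) ^ (b ^ n) = (-1) ^ b := by
  rcases Nat.even_or_odd b with h | h
  · rw [h.neg_one_pow, (h.pow_of_ne_zero hn).neg_one_pow]
  · rw [h.neg_one_pow, h.pow.neg_one_pow]

lemma energy_zero (S : Fin 0 → Equiv.Perm (Fin b)) :
    energy (((b ^ 0 : ℕ) : ℝ)) (fstCoord S) sndCoord = 0 := by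
  simp [energy, pairDiff, pairSum, sqMoment, fstCoord]

lemma energy_succ {n : ℕ} (hb : b ≠ 0) {σ : Equiv.Perm (Fin b)}
    {S : Fin (n + 1) → Equiv.Perm (Fin b)}
    (hS : ∀ i, S i = σ ∨ S i = pbar σ) (hrev : ∀ i k, S i (Fin.rev k) = Fin.rev (S i k)) :
    energy (((b ^ (n + 1) : ℕ) : ℝ)) (fstCoord S) sndCoord
      = energy (((b ^ n : ℕ) : ℝ)) (fstCoord (fun i => S i.succ)) sndCoord
        + energy b (fun k => centered (σ k)) centered
        + (((b ^ n : ℕ) : ℝ) ^ 2 - 1) * ((b : ℝ) ^ 2 - 1) / 9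
        - ((b : ℝ) ^ 2 * ((b ^ n : ℕ) : ℝ) ^ 2 + 1) * (((b ^ n : ℕ) : ℝ) ^ 2 - 1)
          * ((b : ℝ) ^ 2 - 1) / (72 * b ^ 2 * ((b ^ n : ℕ) : ℝ) ^ 2)
        + 2 * ((((b ^ n : ℕ) : ℝ) ^ 2 - (1 - (-1) ^ b ^ n) / 2) / 4)
          * (((b : ℝ) ^ 2 - (1 - (-1) ^ b) / 2) / 4) / (b ^ 2 * ((b ^ n : ℕ) : ℝ) ^ 2) := by
  have h1 := isSymGrid_perm (hrev 0)
  have h2 := isSymGrid_tuple (fun i k => hrev (Fin.succ i) k)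
  have h3 : energy (b : ℝ) (fun k => centered (S 0 k)) centered
      = energy b (fun k => centered (σ k)) centered := by
    rcases hS 0 with h | h
    · rw [h]
    · simp only [h, centered_pbar, energy_neg]
  have key := h1.energy_prod h2 hb (pow_ne_zero n hb)
  rw [h3, h1.grid_fst.sum_abs, h2.grid_snd.sum_abs] at key
  rw [← key, ← energy_comp_equiv _ _ _ (Fin.consEquiv (fun _ => Fin b))]
  simp only [fstCoord_cons, sndCoord_cons]
  congr 1
  push_cast
  ring

lemma energy_tuple {n : ℕ} (hb : b ≠ 0) {σ : Equiv.Perm (Fin b)}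
    {S : Fin (n + 1) → Equiv.Perm (Fin b)}
    (hS : ∀ i, S i = σ ∨ S i = pbar σ) (hrev : ∀ i k, S i (Fin.rev k) = Fin.rev (S i k)) :
    energy (((b ^ (n + 1) : ℕ) : ℝ)) (fstCoord S) sndCoord
      = (n + 1) * (energy b (fun k => centered (σ k)) centered - 7 / 72 * ((b : ℝ) ^ 2 - 1)
          - 1 / 72 * (1 - 1 / (b : ℝ) ^ 2) + 1 / 8 * (1 - (1 - (-1) ^ b) / (2 * (b : ℝ) ^ 2)))
        + 7 / 72 * ((b : ℝ) ^ (n + 1)) ^ 2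
        + ((1 - (-1) ^ b) / 16 - 1 / 72) / ((b : ℝ) ^ (n + 1)) ^ 2 - 5 / 24 := by
  have hb' : (b : ℝ) ≠ 0 := by exact_mod_cast hb
  induction n with
  | zero =>
    rw [energy_succ hb hS hrev, energy_zero]
    field_simp
    push_cast
    ring
  | succ n ih =>
    rw [energy_succ hb hS hrev, ih (fun i => hS i.succ) (fun i k => hrev i.succ k),
      neg_one_pow_pow _ n.succ_ne_zero]
    have hN : (b : ℝ) ^ (n + 1) ≠ 0 := pow_ne_zero _ hb'
    push_cast
    rw [pow_succ (b : ℝ) (n + 1)]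
    generalize (b : ℝ) ^ (n + 1) = M at hN ⊢
    generalize energy (b : ℝ) (fun k => centered (σ k)) centered = z
    rcases neg_one_pow_eq_or ℝ b with h | h <;> rw [h] <;> field_simp <;> ring

end Digits

section Warnock

open MeasureTheory

lemma integral_sum_sum_mul {κ μ : Type} [Fintype κ] [Fintype μ] (c : κ → μ → ℝ)
    (F : κ → μ → ℝ → ℝ) (h : ∀ k l, IntervalIntegrable (F k l) volume 0 1) :
    ∫ x in (0:ℝ)..1, ∑ k, ∑ l, c k l * F k l x
      = ∑ k, ∑ l, c k l * ∫ x in (0:ℝ)..1, F k l x := by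
  simp only [← Fintype.sum_prod_type']
  rw [intervalIntegral.integral_finsetSum fun p _ => (h p.1 p.2).const_mul _]
  exact sum_congr rfl fun p _ => intervalIntegral.integral_const_mul _ _

lemma integral_sum_mul_sum {κ μ : Type} [Fintype κ] [Fintype μ] (c : κ → ℝ) (d : μ → ℝ)
    (f : κ → ℝ → ℝ) (g : μ → ℝ → ℝ)
    (h : ∀ k l, IntervalIntegrable (fun x => f k x * g l x) volume 0 1) :
    ∫ x in (0:ℝ)..1, (∑ k, c k * f k x) * (∑ l, d l * g l x)
      = ∑ k, ∑ l, c k * d l * ∫ x in (0:ℝ)..1, f k x * g l x := by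
  rw [← integral_sum_sum_mul _ _ h]
  congr 1
  ext x
  rw [sum_mul_sum]
  exact sum_congr rfl fun k _ => sum_congr rfl fun l _ => by ring

lemma integral_integral_sum_sq {κ : Type} [Fintype κ] (c : κ → ℝ) (f g : κ → ℝ → ℝ)
    (hf : ∀ k l, IntervalIntegrable (fun x => f k x * f l x) volume 0 1)
    (hg : ∀ k l, IntervalIntegrable (fun x => g k x * g l x) volume 0 1) :
    ∫ x in (0:ℝ)..1, ∫ y in (0:ℝ)..1, (∑ k, c k * f k x * g k y) ^ 2
      = ∑ k, ∑ l, c k * c l * (∫ x in (0:ℝ)..1, f k x * f l x)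
          * ∫ y in (0:ℝ)..1, g k y * g l y := by
  have e : ∀ x, ∫ y in (0:ℝ)..1, (∑ k, c k * f k x * g k y) ^ 2
      = ∑ k, ∑ l, (c k * c l * ∫ y in (0:ℝ)..1, g k y * g l y) * (f k x * f l x) := fun x => by
    simp only [sq]
    rw [integral_sum_mul_sum _ _ _ _ hg]
    exact sum_congr rfl fun k _ => sum_congr rfl fun l _ => by ring
  simp only [e]
  rw [integral_sum_sum_mul _ _ hf]
  exact sum_congr rfl fun k _ => sum_congr rfl fun l _ => by ring

/-- The indicator function of `(t, ∞)`. -/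
def step (t x : ℝ) : ℝ := if t < x then 1 else 0

lemma step_mul_eq_indicator (t : ℝ) (F : ℝ → ℝ) :
    (fun x => step t x * F x) = (Set.Ioi t).indicator F := by
  ext x
  simp [step, Set.indicator]

lemma step_mul_step (s t x : ℝ) : step s x * step t x = step (max s t) x := by
  simp only [step, max_lt_iff]
  split_ifs <;> simp_all

lemma intervalIntegrable_step_mul (t : ℝ) {F : ℝ → ℝ} (hF : Continuous F) :
    IntervalIntegrable (fun x => step t x * F x) volume 0 1 := by
  rw [step_mul_eq_indicator, intervalIntegrable_iff]
  exact (intervalIntegrable_iff.mp (hF.intervalIntegrable 0 1)).indicator measurableSet_Ioi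

lemma integral_step_mul {t : ℝ} (h0 : 0 ≤ t) (h1 : t ≤ 1) (F : ℝ → ℝ) :
    ∫ x in (0:ℝ)..1, step t x * F x = ∫ x in t..1, F x := by
  rw [step_mul_eq_indicator, intervalIntegral.integral_of_le zero_le_one,
    setIntegral_indicator measurableSet_Ioi, Set.Ioc_inter_Ioi, max_eq_right h0,
    intervalIntegral.integral_of_le h1]

lemma integral_step {t : ℝ} (h0 : 0 ≤ t) (h1 : t ≤ 1) :
    ∫ x in (0:ℝ)..1, step t x = 1 - t := by
  have := integral_step_mul h0 h1 (fun _ => 1)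
  simpa using this

lemma integral_step_mul_id {t : ℝ} (h0 : 0 ≤ t) (h1 : t ≤ 1) :
    ∫ x in (0:ℝ)..1, step t x * x = (1 - t ^ 2) / 2 := by
  rw [integral_step_mul h0 h1, integral_id]
  ring

lemma localDisc_eq {ι : Type} [Fintype ι] {P : ι → ℝ × ℝ} (h1 : ∀ i, 0 ≤ (P i).1)
    (h2 : ∀ i, 0 ≤ (P i).2) (x y : ℝ) :
    localDisc P x y = ∑ i, step (P i).1 x * step (P i).2 y - Fintype.card ι * x * y := by
  rw [localDisc, card_filter]
  push_cast
  congr 1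
  refine sum_congr rfl fun i _ => ?_
  simp only [h1, h2, true_and, step]
  split_ifs <;> simp_all

/-- Warnock's formula. -/
lemma integral_localDisc_sq {ι : Type} [Fintype ι] {P : ι → ℝ × ℝ}
    (h1 : ∀ i, (P i).1 ∈ Set.Icc (0:ℝ) 1) (h2 : ∀ i, (P i).2 ∈ Set.Icc (0:ℝ) 1) :
    ∫ x in (0:ℝ)..1, ∫ y in (0:ℝ)..1, localDisc P x y ^ 2
      = ∑ i, ∑ j, (1 - max (P i).1 (P j).1) * (1 - max (P i).2 (P j).2)
        - Fintype.card ι / 2 * ∑ i, (1 - (P i).1 ^ 2) * (1 - (P i).2 ^ 2)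
        + (Fintype.card ι : ℝ) ^ 2 / 9 := by
  let c : Option ι → ℝ := fun k => k.elim (-(Fintype.card ι : ℝ)) fun _ => 1
  let f : (ι → ℝ) → Option ι → ℝ → ℝ := fun t k x => k.elim x fun i => step (t i) x
  have hf : ∀ t k l, IntervalIntegrable (fun x => f t k x * f t l x) volume 0 1 := by
    intro t k l
    rcases k with _ | i <;> rcases l with _ | j <;> simp only [f, Option.elim]
    · exact (by fun_prop : Continuous fun x : ℝ => x * x).intervalIntegrable 0 1
    · simpa only [mul_comm, id] using intervalIntegrable_step_mul (t j) continuous_id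
    · exact intervalIntegrable_step_mul (t i) continuous_id
    · simpa only [step_mul_step, mul_one] using
        intervalIntegrable_step_mul (max (t i) (t j)) (continuous_const (y := (1:ℝ)))
  have e : ∀ x y, localDisc P x y = ∑ k, c k * f (fun i => (P i).1) k x
      * f (fun i => (P i).2) k y := fun x y => by
    rw [localDisc_eq (fun i => (h1 i).1) (fun i => (h2 i).1), Fintype.sum_option]
    simp only [c, f, Option.elim, one_mul]
    ring
  simp only [e]
  rw [integral_integral_sum_sq _ _ _ (hf _) (hf _)]
  have hid : ∫ x in (0:ℝ)..1, x * x = 1 / 3 := by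
    simp only [← sq, integral_pow]; norm_num
  have hmax : ∀ s ∈ Set.Icc (0:ℝ) 1, ∀ t ∈ Set.Icc (0:ℝ) 1,
      ∫ x in (0:ℝ)..1, step s x * step t x = 1 - max s t := fun s hs t ht => by
    simp only [step_mul_step]
    exact integral_step (le_max_of_le_left hs.1) (max_le hs.2 ht.2)
  have hl : ∀ t ∈ Set.Icc (0:ℝ) 1, ∫ x in (0:ℝ)..1, step t x * x = (1 - t ^ 2) / 2 :=
    fun t ht => integral_step_mul_id ht.1 ht.2
  have hr : ∀ t ∈ Set.Icc (0:ℝ) 1, ∫ x in (0:ℝ)..1, x * step t x = (1 - t ^ 2) / 2 :=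
    fun t ht => by simpa only [mul_comm] using hl t ht
  simp only [Fintype.sum_option, c, f, Option.elim, hid, hmax _ (h1 _) _ (h1 _),
    hmax _ (h2 _) _ (h2 _), hl _ (h1 _), hl _ (h2 _), hr _ (h1 _), hr _ (h2 _), one_mul, mul_one,
    sum_add_distrib, mul_sum]
  have e1 : ∀ i, -(Fintype.card ι : ℝ) * ((1 - (P i).1 ^ 2) / 2) * ((1 - (P i).2 ^ 2) / 2)
      = -(1 / 2 * (Fintype.card ι / 2 * ((1 - (P i).1 ^ 2) * (1 - (P i).2 ^ 2)))) :=
    fun i => by ring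
  simp only [e1, sum_neg_distrib, ← mul_sum]
  ring

lemma max_eq_half_add_abs (x y : ℝ) : max x y = (x + y + |x - y|) / 2 := by
  rcases le_total x y with h | h
  · rw [max_eq_right h, abs_of_nonpos (by linarith)]; ring
  · rw [max_eq_left h, abs_of_nonneg (by linarith)]; ring

lemma IsGrid.scaled_mem_Icc {ι : Type} [Fintype ι] {N : ℕ} {u : ι → ℝ} (h : IsGrid N u) (i : ι) :
    (u i + ((N : ℝ) - 1) / 2) / N ∈ Set.Icc (0:ℝ) 1 := by
  obtain ⟨k, j, hkj, hk⟩ := h.exists_nat i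
  have hN : (k : ℝ) + 1 + j = N := by exact_mod_cast hkj
  have hk0 : (0 : ℝ) ≤ k := k.cast_nonneg
  have hj0 : (0 : ℝ) ≤ j := j.cast_nonneg
  have hpos : (0 : ℝ) < N := by linarith
  rw [hk, sub_add_cancel]
  exact ⟨by positivity, by rw [div_le_one hpos]; linarith⟩

lemma one_sub_max_scaled {N : ℝ} (hN : 0 < N) (x y : ℝ) :
    1 - max ((x + (N - 1) / 2) / N) ((y + (N - 1) / 2) / N)
      = (N + 1 - (x + y) - |x - y|) / (2 * N) := by
  rw [max_div_div_right hN.le, max_add_add_right, max_eq_half_add_abs]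
  field_simp
  ring

lemma IsSymGrid.integral_localDisc_sq {ι : Type} [Fintype ι] {N : ℕ} {u v : ι → ℝ} {r : ι → ι}
    (h : IsSymGrid N u v r) (hN : N ≠ 0) {P : Bool × ι → ℝ × ℝ}
    (hP : ∀ i, P (true, i) = ((u i + ((N : ℝ) - 1) / 2) / N, (v i + ((N : ℝ) - 1) / 2) / N))
    (hP' : ∀ i, P (false, i) = ((-u i + ((N : ℝ) - 1) / 2) / N, (v i + ((N : ℝ) - 1) / 2) / N)) :
    ∫ x in (0:ℝ)..1, ∫ y in (0:ℝ)..1, localDisc P x y ^ 2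
      = energy N u v - 7 / 72 * (N : ℝ) ^ 2 + 19 / 12 + 1 / N - 1 / 24 / N ^ 2 := by
  have hN0 : (0 : ℝ) < N := by exact_mod_cast Nat.pos_of_ne_zero hN
  have hN' : (N : ℝ) ≠ 0 := hN0.ne'
  rw [SymHamm.integral_localDisc_sq]
  rotate_left
  · rintro ⟨_ | _, i⟩
    · rw [hP']; exact h.grid_fst.neg.scaled_mem_Icc i
    · rw [hP]; exact h.grid_fst.scaled_mem_Icc i
  · rintro ⟨_ | _, i⟩
    · rw [hP']; exact h.grid_snd.scaled_mem_Icc i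
    · rw [hP]; exact h.grid_snd.scaled_mem_Icc i
  have hcard : (Fintype.card (Bool × ι) : ℝ) = 2 * N := by
    rw [Fintype.card_prod, Fintype.card_bool, h.grid_fst.card]; push_cast; rfl
  have hcι : (Fintype.card ι : ℝ) = N := by rw [h.grid_fst.card]
  have hodd : ∑ i, u i ^ 2 * v i = 0 := h.sum_eq_zero_of_odd (fun x y => x ^ 2 * y)
    fun x y => by ring
  have hrow : ∀ i, ∑ j, (|u i - u j| + |u i + u j|) = 2 * u i ^ 2 + ((N : ℝ) ^ 2 - 1) / 2 := by
    intro i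
    rw [sum_add_distrib, h.grid_fst.sum_abs_sub, h.grid_fst.sum_abs_add]; ring
  have hmix : ∑ i, ∑ j, (|u i - u j| + |u i + u j|) * v i = 0 := by
    have : ∀ i, ∑ j, (|u i - u j| + |u i + u j|) * v i
        = 2 * (u i ^ 2 * v i) + ((N : ℝ) ^ 2 - 1) / 2 * v i := fun i => by
      rw [← sum_mul, hrow]; ring
    simp only [this, sum_add_distrib, ← mul_sum, hodd, h.grid_snd.sum_eq_zero]
    ring
  have hmix' : ∑ i, ∑ j, (|u i - u j| + |u i + u j|) * v j = 0 := by
    rw [sum_comm, ← hmix]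
    exact sum_congr rfl fun i _ => sum_congr rfl fun j _ => by
      rw [abs_sub_comm, add_comm (u j)]
  have hpairs : ∑ p, ∑ q, (1 - max (P p).1 (P q).1) * (1 - max (P p).2 (P q).2)
      = ((N : ℝ) + 1) ^ 2 - 2 * (N + 1) * ((N : ℝ) ^ 2 - 1) / (3 * N)
        + (pairDiff u v + pairSum u v) / (2 * N ^ 2) := by
    have e : ∑ p, ∑ q, (1 - max (P p).1 (P q).1) * (1 - max (P p).2 (P q).2)
        = ((N + 1) ^ 2 / N ^ 2 * ∑ _i : ι, ∑ _j : ι, (1:ℝ))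
          - (N + 1) / N ^ 2 * (∑ i, ∑ _j : ι, v i) - (N + 1) / N ^ 2 * (∑ _i : ι, ∑ j, v j)
          - (N + 1) / N ^ 2 * (∑ i, ∑ j, |v i - v j|)
          - (N + 1) / (2 * N ^ 2) * (∑ i, ∑ j, |u i - u j|)
          - (N + 1) / (2 * N ^ 2) * (∑ i, ∑ j, |u i + u j|)
          + 1 / (2 * N ^ 2) * (∑ i, ∑ j, (|u i - u j| + |u i + u j|) * v i)
          + 1 / (2 * N ^ 2) * (∑ i, ∑ j, (|u i - u j| + |u i + u j|) * v j)
          + (pairDiff u v + pairSum u v) / (2 * N ^ 2) := by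
      rw [pairDiff, pairSum, ← sum_add_distrib, sum_div]
      simp only [Fintype.sum_prod_type, Fintype.sum_bool, hP, hP', one_sub_max_scaled hN0]
      simp only [mul_sum, ← sum_add_distrib, ← sum_sub_distrib, sum_div]
      refine sum_congr rfl fun i _ => sum_congr rfl fun j _ => ?_
      have a1 : |u i - -u j| = |u i + u j| := by rw [sub_neg_eq_add]
      have a2 : |-u i - u j| = |u i + u j| := by rw [← abs_neg]; congr 1; ring
      have a3 : |-u i - -u j| = |u i - u j| := by rw [← abs_neg]; congr 1; ring
      rw [a1, a2, a3]
      field_simp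
      ring
    rw [e, hmix, hmix', h.grid_fst.sum_sum_abs_sub, h.grid_fst.sum_sum_abs_add,
      h.grid_snd.sum_sum_abs_sub, h.grid_snd.sum_eq_zero]
    simp only [sum_const, card_univ, hcι, nsmul_eq_mul, ← mul_sum, h.grid_snd.sum_eq_zero]
    field_simp
    ring
  have hlin : ∑ p, (1 - (P p).1 ^ 2) * (1 - (P p).2 ^ 2)
      = 2 * N * (1 - ((N : ℝ) - 1) ^ 2 / (4 * N ^ 2)) ^ 2
        - (1 - ((N : ℝ) - 1) ^ 2 / (4 * N ^ 2)) * ((N : ℝ) ^ 2 - 1) / (3 * N)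
        + 2 * sqMoment u v / N ^ 4 := by
    have e : ∑ p, (1 - (P p).1 ^ 2) * (1 - (P p).2 ^ 2)
        = 2 * (1 - ((N : ℝ) - 1) ^ 2 / (4 * N ^ 2)) ^ 2 * (∑ _i : ι, (1:ℝ))
          - 2 * (1 - ((N : ℝ) - 1) ^ 2 / (4 * N ^ 2)) / N ^ 2 * (∑ i, u i ^ 2)
          - 2 * (1 - ((N : ℝ) - 1) ^ 2 / (4 * N ^ 2)) / N ^ 2 * (∑ i, v i ^ 2)
          - 2 * (1 - ((N : ℝ) - 1) ^ 2 / (4 * N ^ 2)) * (N - 1) / N ^ 2 * (∑ i, v i)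
          + 2 * (N - 1) / N ^ 4 * (∑ i, u i ^ 2 * v i)
          + 2 / N ^ 4 * ∑ i, u i ^ 2 * v i ^ 2 := by
      simp only [Fintype.sum_prod_type, Fintype.sum_bool, hP, hP', mul_sum, ← sum_add_distrib,
        ← sum_sub_distrib]
      refine sum_congr rfl fun i _ => ?_
      field_simp
      ring
    rw [e, hodd, h.grid_fst.sum_sq, h.grid_snd.sum_sq, h.grid_snd.sum_eq_zero, sqMoment]
    simp only [sum_const, card_univ, hcι, nsmul_eq_mul]
    field_simp
    ring
  rw [hpairs, hlin, hcard, energy]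
  field_simp
  ring

end Warnock

section Ramp

open MeasureTheory

variable {b : ℕ}

/-- The function increasing from `0` to `1` on `[l/b, (l+1)/b]` and constant elsewhere. -/
def ramp (b l : ℕ) (x : ℝ) : ℝ := max 0 (min 1 (b * x - l))

lemma continuous_ramp (b l : ℕ) : Continuous (ramp b l) := by
  unfold ramp
  fun_prop

lemma ramp_eq_zero {l : ℕ} {x : ℝ} (h : b * x ≤ l) : ramp b l x = 0 := by
  rw [ramp, min_eq_right (by linarith), max_eq_left (by linarith)]

lemma ramp_eq_one {l : ℕ} {x : ℝ} (h : (l : ℝ) + 1 ≤ b * x) : ramp b l x = 1 := by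
  rw [ramp, min_eq_left (by linarith), max_eq_right (by linarith)]

lemma ramp_eq_sub {l : ℕ} {x : ℝ} (h : (l : ℝ) ≤ b * x) (h' : b * x ≤ l + 1) :
    ramp b l x = b * x - l := by
  rw [ramp, min_eq_right (by linarith), max_eq_right (by linarith)]

lemma sum_mul_ramp (g : ℕ → ℝ) {k : ℕ} {x : ℝ} (hk : k < b) (h : (k : ℝ) ≤ b * x)
    (h' : b * x < k + 1) :
    ∑ l ∈ range b, g l * ramp b l x = ∑ l ∈ range k, g l + g k * (b * x - k) := by
  have hsub : range (k + 1) ⊆ range b := range_subset_range.mpr hk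
  rw [← sum_subset hsub, sum_range_succ, ramp_eq_sub h h'.le]
  · congr 1
    refine sum_congr rfl fun l hl => ?_
    have : (l : ℝ) + 1 ≤ k := by exact_mod_cast mem_range.mp hl
    rw [ramp_eq_one (this.trans h), mul_one]
  · intro l _ hl
    have : (k : ℝ) + 1 ≤ l := by
      rw [mem_range, not_lt] at hl
      exact_mod_cast hl
    rw [ramp_eq_zero (h'.le.trans this), mul_zero]

lemma integral_ramp_mul_ramp_of_le {l m : ℕ} (hlm : m ≤ l) (hl : l < b) :
    ∫ x in (0:ℝ)..1, ramp b l x * ramp b m x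
      = 1 - (l + 1 / 2 + zeroInd ((l : ℝ) - m) / 6) / b := by
  have hb : (0 : ℝ) < b := by exact_mod_cast (by omega : 0 < b)
  have hl0 : (0 : ℝ) ≤ l := l.cast_nonneg
  have hlb : (l : ℝ) + 1 ≤ b := by exact_mod_cast hl
  have hml : (m : ℝ) ≤ l := by exact_mod_cast hlm
  have hint : ∀ s t : ℝ, IntervalIntegrable (fun x => ramp b l x * ramp b m x) volume s t :=
    fun s t => ((continuous_ramp b l).mul (continuous_ramp b m)).intervalIntegrable s t
  have hp : (l : ℝ) / b ≤ (l + 1) / b := by gcongr; linarith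
  rw [← intervalIntegral.integral_add_adjacent_intervals (hint 0 ((l + 1) / b)) (hint _ 1),
    ← intervalIntegral.integral_add_adjacent_intervals (hint 0 (l / b)) (hint _ _)]
  have i1 : ∫ x in (0:ℝ)..(l / b), ramp b l x * ramp b m x = 0 := by
    rw [intervalIntegral.integral_congr (g := fun _ => (0:ℝ)), intervalIntegral.integral_zero]
    intro x hx
    rw [Set.uIcc_of_le (by positivity), Set.mem_Icc, le_div_iff₀ hb] at hx
    simp only
    rw [ramp_eq_zero (by linarith), zero_mul]
  have i3 : ∫ x in ((l + 1) / b : ℝ)..1, ramp b l x * ramp b m x = 1 - (l + 1) / b := by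
    rw [intervalIntegral.integral_congr (g := fun _ => (1:ℝ)), intervalIntegral.integral_const,
      smul_eq_mul, mul_one]
    intro x hx
    rw [Set.uIcc_of_le (by rw [div_le_one hb]; exact hlb), Set.mem_Icc, div_le_iff₀ hb] at hx
    simp only
    rw [ramp_eq_one (by linarith), ramp_eq_one (by linarith), one_mul]
  have i2 : ∫ x in (l / b : ℝ)..((l + 1) / b), ramp b l x * ramp b m x
      = (1 / 2 - zeroInd ((l : ℝ) - m) / 6) / b := by
    rcases hlm.eq_or_lt with rfl | hlt
    · have e : Set.EqOn (fun x => ramp b m x * ramp b m x) (fun x => ((b : ℝ) * x - m) ^ 2)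
          (Set.uIcc ((m : ℝ) / b) ((m + 1) / b)) := by
        intro x hx
        rw [Set.uIcc_of_le hp, Set.mem_Icc, div_le_iff₀ hb, le_div_iff₀ hb] at hx
        simp only
        rw [ramp_eq_sub (by linarith) (by linarith)]
        ring
      rw [intervalIntegral.integral_congr e,
        intervalIntegral.integral_comp_mul_sub (fun x => x ^ 2) hb.ne', integral_pow,
        mul_div_cancel₀ _ hb.ne', mul_div_cancel₀ _ hb.ne']
      simp only [sub_self, add_sub_cancel_left, zeroInd, if_true, smul_eq_mul]
      field_simp
      norm_num
    · have hml' : (m : ℝ) + 1 ≤ l := by exact_mod_cast hlt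
      have e : Set.EqOn (fun x => ramp b l x * ramp b m x) (fun x => ((b : ℝ) * x - l) ^ 1)
          (Set.uIcc ((l : ℝ) / b) ((l + 1) / b)) := by
        intro x hx
        rw [Set.uIcc_of_le hp, Set.mem_Icc, div_le_iff₀ hb, le_div_iff₀ hb] at hx
        simp only
        rw [ramp_eq_sub (by linarith) (by linarith), ramp_eq_one (by linarith)]
        ring
      rw [intervalIntegral.integral_congr e,
        intervalIntegral.integral_comp_mul_sub (fun x => x ^ 1) hb.ne', integral_pow,
        mul_div_cancel₀ _ hb.ne', mul_div_cancel₀ _ hb.ne', zeroInd, if_neg (by linarith)]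
      simp only [sub_self, add_sub_cancel_left, smul_eq_mul]
      field_simp
      norm_num
  rw [i1, i2, i3]
  field_simp
  ring

lemma integral_ramp_mul_ramp (l m : Fin b) :
    ∫ x in (0:ℝ)..1, ramp b l x * ramp b m x
      = 1 / 2 - centered l / (2 * b) - centered m / (2 * b)
        - (|centered l - centered m| / 2 + zeroInd (centered l - centered m) / 6) / b := by
  have hb : (0 : ℝ) < b := by exact_mod_cast l.pos
  have hsub : ∀ p q : Fin b, centered p - centered q = ((p : ℕ) : ℝ) - (q : ℕ) := fun p q => by
    simp only [centered]; ring
  wlog h : (m : ℕ) ≤ l generalizing l m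
  · have := this m l (by omega)
    simp only [mul_comm (ramp b m _)] at this
    rw [this, ← abs_neg, ← zeroInd_neg, neg_sub]
    ring
  · have hml : ((m : ℕ) : ℝ) ≤ (l : ℕ) := by exact_mod_cast h
    rw [integral_ramp_mul_ramp_of_le h l.2, hsub, abs_of_nonneg (by linarith)]
    simp only [centered]
    field_simp
    ring

/-- The deviation of the indicator of `s < h` from `h/b`. -/
def weight (b s h : ℕ) : ℝ := step s h - h / b

lemma phi_eq_sum_ramp (hb0 : b ≠ 0) (σ : Equiv.Perm (Fin b)) (h : ℕ) {x : ℝ} (hx : x ∈ Set.Ico (0:ℝ) 1) :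
    phi σ h x = ∑ l : Fin b, weight b (σ l) h * ramp b l x := by
  have hb : (0 : ℝ) < b := by exact_mod_cast Nat.pos_of_ne_zero hb0
  have hfr : Int.fract x = x := Int.fract_eq_self.mpr hx
  have hbx : 0 ≤ b * x := mul_nonneg hb.le hx.1
  obtain ⟨k, hk⟩ : ∃ k : ℕ, k = (⌊(b : ℝ) * x⌋).toNat := ⟨_, rfl⟩
  have hkf : k = ⌊(b : ℝ) * x⌋₊ := hk
  have hk1 : (k : ℝ) ≤ b * x := hkf ▸ Nat.floor_le hbx
  have hk2 : b * x < k + 1 := hkf ▸ Nat.lt_floor_add_one _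
  have hkb : k < b := by
    have : (k : ℝ) < b := hk1.trans_lt (by nlinarith [hx.2])
    exact_mod_cast this
  have hval : ∀ l : Fin b, ((σ l : ℕ)) = permVal σ l := fun l => by simp [permVal]
  simp only [hval]
  rw [Fin.sum_univ_eq_sum_range (fun l => weight b (permVal σ l) h * ramp b l x),
    sum_mul_ramp (fun l => weight b (permVal σ l) h) hkb hk1 hk2, phi, hfr, ← hk]
  have hcount : ∀ n : ℕ, ∑ l ∈ range n, weight b (permVal σ l) h
      = (((range n).filter (fun l => permVal σ l < h)).card : ℝ) - n * (h / b) := fun n => by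
    simp only [weight, sum_sub_distrib, step, Nat.cast_lt, sum_const, card_range, nsmul_eq_mul,
      sum_boole]
  have hcompl : ∀ n : ℕ, (((range n).filter (fun l => h ≤ permVal σ l)).card : ℝ)
      = n - ((range n).filter (fun l => permVal σ l < h)).card := fun n => by
    have := card_filter_add_card_filter_not (s := range n) (fun l => permVal σ l < h)
    simp only [not_lt, card_range] at this
    rw [eq_sub_iff_add_eq, add_comm]
    exact_mod_cast this
  rw [hcount]
  split_ifs with hc
  · rw [range_add_one, filter_insert, if_neg (not_lt.mpr hc), weight, step,
      if_neg (not_lt.mpr (by exact_mod_cast hc))]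
    field_simp
    ring
  · rw [range_add_one, filter_insert, if_neg hc, weight, step,
      if_pos (by exact_mod_cast not_le.mp hc), hcompl]
    field_simp
    ring

lemma sum_step_of_lt {s n : ℕ} (h : s < n) :
    ∑ k ∈ range n, step s k = (n : ℝ) - 1 - s := by
  obtain ⟨j, rfl⟩ := Nat.exists_eq_add_of_le h
  induction j with
  | zero =>
    rw [sum_eq_zero fun k hk => ?_]
    · push_cast; ring
    · have hk' : k ≤ s := Nat.lt_succ_iff.mp (mem_range.mp hk)
      exact if_neg (not_lt.mpr (by exact_mod_cast hk'))
  | succ j ih =>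
    rw [← add_assoc, sum_range_succ, ih (by omega), step,
      if_pos (by exact_mod_cast (by omega : s < s.succ + j))]
    push_cast; ring

lemma sum_step_mul_of_lt {s n : ℕ} (h : s < n) :
    ∑ k ∈ range n, step s k * k = (n : ℝ) * (n - 1) / 2 - s * (s + 1) / 2 := by
  obtain ⟨j, rfl⟩ := Nat.exists_eq_add_of_le h
  induction j with
  | zero =>
    rw [sum_eq_zero fun k hk => ?_]
    · push_cast; ring
    · have hk' : k ≤ s := Nat.lt_succ_iff.mp (mem_range.mp hk)
      rw [step, if_neg (not_lt.mpr (by exact_mod_cast hk')), zero_mul]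
  | succ j ih =>
    rw [← add_assoc, sum_range_succ, ih (by omega), step,
      if_pos (by exact_mod_cast (by omega : s < s.succ + j))]
    push_cast; ring

lemma sum_weight (σ : Equiv.Perm (Fin b)) {h : ℕ} (hh : h ≤ b) :
    ∑ l, weight b (σ l) h = 0 := by
  rcases Nat.eq_zero_or_pos b with rfl | hb0
  · simp
  have hb : (b : ℝ) ≠ 0 := by exact_mod_cast hb0.ne'
  rw [Equiv.sum_comp σ (fun s => weight b s h),
    Fin.sum_univ_eq_sum_range (fun s => weight b s h)]
  simp only [weight, sum_sub_distrib, sum_const, card_range, nsmul_eq_mul, step, Nat.cast_lt,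
    sum_boole]
  have : (range b).filter (fun s => s < h) = range h := by
    ext s; simp only [mem_filter, mem_range]; omega
  rw [this, card_range]
  field_simp
  ring

/-- The kernel `|l - m|/2`, with an additional mass `1/6` on the diagonal. -/
def kernel (l m : Fin b) : ℝ :=
  |centered l - centered m| / 2 + zeroInd (centered l - centered m) / 6

lemma integral_sum_phi_mul_phi (hb0 : b ≠ 0) (σ ρ : Equiv.Perm (Fin b)) (m : ℕ) {f g : ℕ → ℕ}
    (hf : ∀ h ∈ range m, f h ≤ b) (hg : ∀ h ∈ range m, g h ≤ b) :
    (1 / (b : ℝ)) * ∫ x in (0:ℝ)..1, ∑ h ∈ range m, phi σ (f h) x * phi ρ (g h) x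
      = -(1 / (b : ℝ) ^ 2) * ∑ l, ∑ k, kernel l k
          * ∑ h ∈ range m, weight b (σ l) (f h) * weight b (ρ k) (g h) := by
  have hint : ∀ l k : Fin b, IntervalIntegrable (fun x => ramp b l x * ramp b k x) volume 0 1 :=
    fun l k => ((continuous_ramp b l).mul (continuous_ramp b k)).intervalIntegrable 0 1
  have e1 : ∫ x in (0:ℝ)..1, ∑ h ∈ range m, phi σ (f h) x * phi ρ (g h) x
      = ∫ x in (0:ℝ)..1, ∑ h ∈ range m, (∑ l, weight b (σ l) (f h) * ramp b l x)
          * ∑ k, weight b (ρ k) (g h) * ramp b k x := by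
    rw [intervalIntegral.integral_of_le zero_le_one, intervalIntegral.integral_of_le zero_le_one,
      ← integral_Ico_eq_integral_Ioc, ← integral_Ico_eq_integral_Ioc]
    refine setIntegral_congr_fun measurableSet_Ico fun x hx => ?_
    exact sum_congr rfl fun h _ => by rw [phi_eq_sum_ramp hb0 σ _ hx, phi_eq_sum_ramp hb0 ρ _ hx]
  have hcont : ∀ l : Fin b, Continuous (ramp b l) := fun l => continuous_ramp b l
  rw [e1, intervalIntegral.integral_finsetSum fun h _ => by
    apply Continuous.intervalIntegrable
    fun_prop]
  have e2 : ∀ h ∈ range m, ∫ x in (0:ℝ)..1, (∑ l, weight b (σ l) (f h) * ramp b l x)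
      * ∑ k, weight b (ρ k) (g h) * ramp b k x
      = -(1 / (b : ℝ)) * ∑ l, ∑ k, kernel l k * (weight b (σ l) (f h) * weight b (ρ k) (g h)) := by
    intro h hh
    rw [integral_sum_mul_sum _ _ _ _ hint]
    have e : ∀ l k : Fin b, weight b (σ l) (f h) * weight b (ρ k) (g h)
        * ∫ x in (0:ℝ)..1, ramp b l x * ramp b k x
        = (1 / 2 - centered l / (2 * b)) * weight b (σ l) (f h) * weight b (ρ k) (g h)
          - weight b (σ l) (f h) * (centered k / (2 * b) * weight b (ρ k) (g h))
          + -(1 / (b : ℝ)) * (kernel l k * (weight b (σ l) (f h) * weight b (ρ k) (g h))) := by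
      intro l k
      rw [integral_ramp_mul_ramp, kernel]
      ring
    simp only [e, sum_add_distrib, sum_sub_distrib, ← mul_sum, ← sum_mul]
    rw [sum_weight σ (hf h hh), sum_weight ρ (hg h hh)]
    ring
  rw [sum_congr rfl e2, ← mul_sum, sum_comm, ← mul_assoc]
  congr 1
  · ring
  · refine sum_congr rfl fun l _ => ?_
    rw [sum_comm]
    exact sum_congr rfl fun k _ => (mul_sum _ _ _).symm

lemma sum_range_sq (n : ℕ) :
    ∑ k ∈ range n, (k : ℝ) ^ 2 = n * ((n : ℝ) - 1) * (2 * n - 1) / 6 := by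
  induction n with
  | zero => simp
  | succ n ih => rw [sum_range_succ, ih]; push_cast; ring

lemma sum_range_cast (n : ℕ) : ∑ k ∈ range n, (k : ℝ) = n * ((n : ℝ) - 1) / 2 := by
  induction n with
  | zero => simp
  | succ n ih => rw [sum_range_succ, ih]; push_cast; ring

lemma sum_weight_mul_weight (s t : Fin b) :
    ∑ h ∈ range b, weight b s h * weight b t h
      = ((b : ℝ) ^ 2 - 1) / (12 * b) - |centered s - centered t| / 2
        + (centered s ^ 2 + centered t ^ 2) / (2 * b) := by
  have hb : (b : ℝ) ≠ 0 := by exact_mod_cast s.pos.ne'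
  have e : ∀ h : ℕ, weight b s h * weight b t h = step ((max (s : ℕ) t : ℕ) : ℝ) h
      - 1 / b * (step (s : ℕ) h * h) - 1 / b * (step (t : ℕ) h * h) + 1 / b ^ 2 * (h : ℝ) ^ 2 := by
    intro h
    rw [Nat.cast_max, ← step_mul_step, weight, weight]
    field_simp
    ring
  simp only [e, sum_add_distrib, sum_sub_distrib, ← mul_sum]
  rw [sum_step_of_lt (max_lt s.2 t.2), sum_step_mul_of_lt s.2, sum_step_mul_of_lt t.2,
    sum_range_sq, Nat.cast_max, max_eq_half_add_abs]
  have : centered s - centered t = ((s : ℕ) : ℝ) - (t : ℕ) := by simp only [centered]; ring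
  rw [this]
  simp only [centered]
  field_simp
  ring

lemma sum_weight_succ_mul_weight (s t : Fin b) :
    ∑ h ∈ range (b - 1), weight b s (h + 1) * weight b t h
      = (∑ h ∈ range b, step (s : ℕ) ((h + 1 : ℕ) : ℝ) * step (t : ℕ) h)
        - (b : ℝ) + (((s : ℕ) : ℝ) * ((s : ℕ) - 1) + ((t : ℕ) + 1) * ((t : ℕ) + 2)) / (2 * b)
        + ((b : ℝ) ^ 2 - 1) / (3 * b) := by
  have hb0 : 0 < b := s.pos
  have hb : (b : ℝ) ≠ 0 := by exact_mod_cast hb0.ne'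
  have hlast : weight b s b = 0 := by
    rw [weight, step, if_pos (by exact_mod_cast s.2), div_self hb, sub_self]
  have hext : ∑ h ∈ range (b - 1), weight b s (h + 1) * weight b t h
      = ∑ h ∈ range b, weight b s (h + 1) * weight b t h := by
    have hlast' : weight b s (b - 1 + 1) = 0 := by rw [Nat.sub_add_cancel hb0, hlast]
    have := sum_range_succ (fun h => weight b s (h + 1) * weight b t h) (b - 1)
    rw [hlast', zero_mul, add_zero, Nat.sub_add_cancel hb0] at this
    exact this.symm
  have hshift : ∀ F : ℕ → ℝ, ∑ h ∈ range b, step (s : ℕ) ((h + 1 : ℕ) : ℝ) * F (h + 1)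
      = ∑ h ∈ range (b + 1), step (s : ℕ) h * F h := fun F => by
    rw [sum_range_succ' (fun h => step (s : ℕ) h * F h)]
    simp [step]
  have h0 := hshift fun _ => 1
  have h1 := hshift fun h => h
  simp only [mul_one] at h0
  rw [sum_step_of_lt (by omega)] at h0
  rw [sum_step_mul_of_lt (by omega)] at h1
  have e : ∀ h : ℕ, weight b s (h + 1) * weight b t h
      = step (s : ℕ) ((h + 1 : ℕ) : ℝ) * step (t : ℕ) h
        - 1 / b * (step (s : ℕ) ((h + 1 : ℕ) : ℝ) * ((h + 1 : ℕ) : ℝ))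
        + 1 / b * step (s : ℕ) ((h + 1 : ℕ) : ℝ)
        - 1 / b * (step (t : ℕ) h * h) - 1 / b * step (t : ℕ) h
        + 1 / b ^ 2 * (h : ℝ) ^ 2 + 1 / b ^ 2 * (h : ℝ) := by
    intro h
    rw [weight, weight]
    push_cast
    field_simp
    ring
  rw [hext]
  simp only [e, sum_add_distrib, sum_sub_distrib, ← mul_sum, h0, h1, sum_step_of_lt t.2,
    sum_step_mul_of_lt t.2, sum_range_sq, sum_range_cast]
  push_cast
  field_simp
  ring

lemma sum_step_succ_mul_step (s t : Fin b) :
    ∑ h ∈ range b, step (s : ℕ) ((h + 1 : ℕ) : ℝ) * step (t : ℕ) h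
      = (b : ℝ) - (if s ≤ t then ((t : ℕ) : ℝ) + 1 else (s : ℕ)) := by
  split_ifs with hst
  · have hst' : (s : ℕ) ≤ t := hst
    rw [← sub_sub, sub_right_comm, ← sum_step_of_lt t.2]
    refine sum_congr rfl fun h _ => ?_
    simp only [step, Nat.cast_lt]
    split_ifs <;> first | omega | simp
  · have hst' : (t : ℕ) < s := not_le.mp hst
    have h0 := sum_step_of_lt (show (s : ℕ) < b + 1 by omega)
    rw [sum_range_succ'] at h0
    rw [show (b : ℝ) - (s : ℕ) = ((b + 1 : ℕ) : ℝ) - 1 - (s : ℕ) by push_cast; ring, ← h0]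
    rw [show step ((s : ℕ) : ℝ) ((0 : ℕ) : ℝ) = 0 by simp [step], add_zero]
    refine sum_congr rfl fun h _ => ?_
    simp only [step, Nat.cast_lt]
    split_ifs <;> first | omega | simp

lemma sum_weight_shift (s t : Fin b) :
    1 / 2 * ∑ h ∈ range (b - 1), weight b s (h + 1) * weight b t h
        + 1 / 2 * ∑ h ∈ range (b - 1), weight b s h * weight b t (h + 1)
      = ((b : ℝ) ^ 2 + 5) / (12 * b) - |centered s - centered t| / 2
        + (centered s ^ 2 + centered t ^ 2) / (2 * b)
        - zeroInd (centered s - centered t) / 2 := by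
  have hb : (b : ℝ) ≠ 0 := by exact_mod_cast s.pos.ne'
  have hsub : centered s - centered t = ((s : ℕ) : ℝ) - (t : ℕ) := by simp only [centered]; ring
  simp only [mul_comm (weight b s _) (weight b t (_ + 1))]
  rw [sum_weight_succ_mul_weight, sum_weight_succ_mul_weight, sum_step_succ_mul_step,
    sum_step_succ_mul_step, hsub]
  simp only [centered]
  rcases lt_trichotomy s t with h | h | h
  · have h' : ((s : ℕ) : ℝ) < (t : ℕ) := by exact_mod_cast h
    rw [if_pos h.le, if_neg (not_le.mpr h), abs_of_neg (by linarith), zeroInd,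
      if_neg (by linarith)]
    field_simp
    ring
  · subst h
    simp only [le_refl, if_true, sub_self, abs_zero, zeroInd]
    field_simp
    ring
  · have h' : ((t : ℕ) : ℝ) < (s : ℕ) := by exact_mod_cast h
    rw [if_pos h.le, if_neg (not_le.mpr h), abs_of_pos (by linarith), zeroInd,
      if_neg (by linarith)]
    field_simp
    ring

lemma sum_zeroInd_centered (N : ℕ) :
    ∑ k ∈ range N, zeroInd ((k : ℝ) - ((N : ℝ) - 1) / 2 + ((k : ℝ) - ((N : ℝ) - 1) / 2))
      = (1 - (-1) ^ N) / 2 := by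
  induction N using Nat.twoStepInduction with
  | zero => simp
  | one => simp [zeroInd]
  | more N ih _ =>
    have hN : (0 : ℝ) ≤ N := N.cast_nonneg
    have h1 : ∀ k : ℕ, ((k + 1 : ℕ) : ℝ) - (((N + 2 : ℕ) : ℝ) - 1) / 2
        = (k : ℝ) - ((N : ℝ) - 1) / 2 := fun k => by push_cast; ring
    rw [sum_range_succ', sum_range_succ]
    simp only [h1]
    rw [ih, zeroInd, if_neg (by linarith), zeroInd, if_neg (by push_cast; linarith)]
    ring

lemma digit_constant_eq {σ : Equiv.Perm (Fin b)} (hσ : ∀ k, σ (Fin.rev k) = Fin.rev (σ k))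
    (hb : b ≠ 0) :
    2 * PhiS2 σ + PhiT σ + 1 / 2 * PhiT1 σ + 1 / 2 * PhiT2 σ
      = energy b (fun k => centered (σ k)) centered - 7 / 72 * ((b : ℝ) ^ 2 - 1)
          - 1 / 72 * (1 - 1 / (b : ℝ) ^ 2)
          + 1 / 8 * (1 - (1 - (-1) ^ b) / (2 * (b : ℝ) ^ 2)) := by
  have hb' : (b : ℝ) ≠ 0 := by exact_mod_cast hb
  have hsym := isSymGrid_perm hσ
  have hle : ∀ h ∈ range b, h ≤ b := fun h hh => (mem_range.mp hh).le
  have hle' : ∀ h ∈ range (b - 1), h ≤ b := fun h hh => by have := mem_range.mp hh; omega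
  have hle1 : ∀ h ∈ range (b - 1), h + 1 ≤ b := fun h hh => by have := mem_range.mp hh; omega
  have p1 := integral_sum_phi_mul_phi hb σ σ b hle hle
  have p2 := integral_sum_phi_mul_phi hb σ (pbar σ) b hle hle
  have p3 := integral_sum_phi_mul_phi hb σ (pbar σ) (b - 1) hle1 hle'
  have p4 := integral_sum_phi_mul_phi hb σ (pbar σ) (b - 1) hle' hle1
  simp only [PhiS2, PhiT, PhiT1, PhiT2, phiS2, phiT, phiT1, phiT2, sq (phi σ _ _)]
  rw [p1, p2, p3, p4]
  have hterm : ∀ l k : Fin b,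
      2 * (kernel l k * ∑ h ∈ range b, weight b (σ l) h * weight b (σ k) h)
        + kernel l k * ∑ h ∈ range b, weight b (σ l) h * weight b (pbar σ k) h
        + 1 / 2 * (kernel l k *
            ∑ h ∈ range (b - 1), weight b (σ l) (h + 1) * weight b (pbar σ k) h)
        + 1 / 2 * (kernel l k *
            ∑ h ∈ range (b - 1), weight b (σ l) h * weight b (pbar σ k) (h + 1))
      = (2 * (b : ℝ) ^ 2 + 1) / (12 * b) * |centered l - centered k|
        - 1 / 2 * (|centered (σ l) - centered (σ k)| * |centered l - centered k|)
        - 1 / 2 * (|centered (σ l) + centered (σ k)| * |centered l - centered k|)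
        + 1 / b * (centered (σ l) ^ 2 * |centered l - centered k|)
        + 1 / b * (centered (σ k) ^ 2 * |centered l - centered k|)
        - 1 / 4 * (zeroInd (centered (σ l) + centered (σ k)) * |centered l - centered k|)
        + 1 / 6 * (zeroInd (centered l - centered k) * ((2 * (b : ℝ) ^ 2 + 1) / (6 * b)
          - |centered (σ l) - centered (σ k)| - |centered (σ l) + centered (σ k)|
          + 2 / b * (centered (σ l) ^ 2 + centered (σ k) ^ 2)
          - 1 / 2 * zeroInd (centered (σ l) + centered (σ k)))) := by
    intro l k
    have g12 := sum_weight_shift (σ l) (pbar σ k)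
    have g := sum_weight_mul_weight (σ l) (pbar σ k)
    rw [centered_pbar, sub_neg_eq_add, neg_sq] at g12 g
    rw [sum_weight_mul_weight, g]
    linear_combination (norm := skip) kernel l k * g12
    rw [kernel]
    field_simp
    ring
  have hdiag : ∑ l : Fin b, ∑ k : Fin b, zeroInd (centered l - centered k)
        * ((2 * (b : ℝ) ^ 2 + 1) / (6 * b)
          - |centered (σ l) - centered (σ k)| - |centered (σ l) + centered (σ k)|
          + 2 / b * (centered (σ l) ^ 2 + centered (σ k) ^ 2)
          - 1 / 2 * zeroInd (centered (σ l) + centered (σ k)))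
      = (2 * (b : ℝ) ^ 2 + 1) / 6 - 2 * (((b : ℝ) ^ 2 - (1 - (-1) ^ b) / 2) / 4)
        + 4 / b * (b * ((b : ℝ) ^ 2 - 1) / 12) - 1 / 2 * ((1 - (-1) ^ b) / 2) := by
    rw [sum_zeroInd_sub_mul hsym.grid_snd.injective]
    have hz := hsym.grid_fst.sum_comp (fun x => zeroInd (x + x))
    rw [sum_zeroInd_centered] at hz
    have e : ∀ l : Fin b, (2 * (b : ℝ) ^ 2 + 1) / (6 * b)
          - |centered (σ l) - centered (σ l)| - |centered (σ l) + centered (σ l)|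
          + 2 / b * (centered (σ l) ^ 2 + centered (σ l) ^ 2)
          - 1 / 2 * zeroInd (centered (σ l) + centered (σ l))
        = (2 * (b : ℝ) ^ 2 + 1) / (6 * b) - 2 * |centered (σ l)|
          + 4 / b * centered (σ l) ^ 2
          - 1 / 2 * zeroInd (centered (σ l) + centered (σ l)) := fun l => by
      rw [sub_self, abs_zero, ← two_mul (centered (σ l)), abs_mul, abs_two]
      ring
    simp only [e, sum_add_distrib, sum_sub_distrib, ← mul_sum, hz, hsym.grid_fst.sum_abs,
      hsym.grid_fst.sum_sq, sum_const, card_univ, Fintype.card_fin, nsmul_eq_mul]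
    field_simp
  have hrefl : ∑ l : Fin b, ∑ k : Fin b, zeroInd (centered (σ l) + centered (σ k))
      * |centered l - centered k| = 2 * (((b : ℝ) ^ 2 - (1 - (-1) ^ b) / 2) / 4) := by
    rw [hsym.sum_zeroInd_add_mul (fun l k => |centered l - centered k|),
      ← hsym.grid_snd.sum_abs, mul_sum]
    refine sum_congr rfl fun l _ => ?_
    rw [centered_rev, sub_neg_eq_add, ← two_mul, abs_mul, abs_two]
  have hsq : ∑ l : Fin b, centered (σ l) ^ 2 * ∑ k : Fin b, |centered l - centered k|
      = sqMoment (fun k => centered (σ k)) centered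
        + ((b : ℝ) ^ 2 - 1) / 4 * (b * ((b : ℝ) ^ 2 - 1) / 12) := by
    rw [← hsym.grid_fst.sum_sq, sqMoment, mul_sum, ← sum_add_distrib]
    refine sum_congr rfl fun l _ => ?_
    rw [hsym.grid_snd.sum_abs_sub]
    ring
  have hsq' : ∑ l : Fin b, ∑ k : Fin b, centered (σ k) ^ 2 * |centered l - centered k|
      = sqMoment (fun k => centered (σ k)) centered
        + ((b : ℝ) ^ 2 - 1) / 4 * (b * ((b : ℝ) ^ 2 - 1) / 12) := by
    rw [sum_comm, ← hsq]
    refine sum_congr rfl fun l _ => ?_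
    rw [mul_sum]
    exact sum_congr rfl fun k _ => by rw [abs_sub_comm]
  have hsum := sum_congr (rfl : (univ : Finset (Fin b)) = univ) fun l _ =>
    sum_congr (rfl : (univ : Finset (Fin b)) = univ) fun k _ => hterm l k
  simp only [sum_add_distrib, sum_sub_distrib, ← mul_sum] at hsum
  rw [hsym.grid_snd.sum_sum_abs_sub, hrefl, hdiag, hsq, hsq'] at hsum
  rw [energy, pairDiff, pairSum]
  linear_combination (norm := skip) -(1 / (b : ℝ) ^ 2) * hsum
  field_simp
  ring

end Ramp

lemma hammPt_eq {b n : ℕ} (hb : b ≠ 0) (S : Fin n → Equiv.Perm (Fin b)) (a : Fin n → Fin b) :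
    hammPt b n S a = ((fstCoord S a + (((b ^ n : ℕ) : ℝ) - 1) / 2) / (b ^ n : ℕ),
      (sndCoord a + (((b ^ n : ℕ) : ℝ) - 1) / 2) / (b ^ n : ℕ)) := by
  have hb' : (b : ℝ) ≠ 0 := by exact_mod_cast hb
  have hgeom : ∑ j : Fin n, (b : ℝ) ^ (j : ℕ) * ((b : ℝ) - 1) = (b : ℝ) ^ n - 1 := by
    rw [Fin.sum_univ_eq_sum_range (fun j => (b : ℝ) ^ j * ((b : ℝ) - 1)), ← sum_mul,
      geom_sum_mul]
  have hgeom' : ∑ j : Fin n, (b : ℝ) ^ (n - 1 - (j : ℕ)) * ((b : ℝ) - 1) = (b : ℝ) ^ n - 1 := by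
    rw [Fin.sum_univ_eq_sum_range (fun j => (b : ℝ) ^ (n - 1 - j) * ((b : ℝ) - 1)),
      sum_range_reflect (fun j => (b : ℝ) ^ j * ((b : ℝ) - 1)), ← sum_mul, geom_sum_mul]
  rw [hammPt]
  push_cast
  congr 1
  · rw [eq_div_iff (pow_ne_zero _ hb'), ← hgeom, fstCoord, sum_mul, sum_div, ← sum_add_distrib]
    refine sum_congr rfl fun j _ => ?_
    have hpow : (b : ℝ) ^ n = b ^ (j : ℕ) * b ^ (n - (j : ℕ)) := by
      rw [← pow_add, Nat.add_sub_cancel' j.2.le]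
    rw [div_mul_eq_mul_div, div_eq_iff (pow_ne_zero _ hb'), hpow, centered]
    ring
  · rw [eq_div_iff (pow_ne_zero _ hb'), ← hgeom', sndCoord, sum_mul, sum_div, ← sum_add_distrib]
    refine sum_congr rfl fun j _ => ?_
    have hpow : (b : ℝ) ^ n = b ^ (n - 1 - (j : ℕ)) * b ^ ((j : ℕ) + 1) := by
      rw [← pow_add]; congr 1; have := j.2; omega
    rw [div_mul_eq_mul_div, div_eq_iff (pow_ne_zero _ hb'), hpow, centered]
    ring


theorem stmt0 (b : ℕ) (hb : 2 ≤ b) (σ : Equiv.Perm (Fin b))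
    (hcomm : (tauP b).trans σ = σ.trans (tauP b))
    (n : ℕ) (hn : 1 ≤ n) (S : Fin n → Equiv.Perm (Fin b))
    (hS : ∀ i, S i = σ ∨ S i = pbar σ) :
    (2 * (b : ℝ) ^ n * L2disc (symFam b n S)) ^ 2 =
      (n : ℝ) * (2 * PhiS2 σ + PhiT σ + (1 / 2) * PhiT1 σ + (1 / 2) * PhiT2 σ)
        + 11 / 8 + 1 / (b : ℝ) ^ n
        + (1 - 9 * (-1 : ℝ) ^ b) / (144 * (b : ℝ) ^ (2 * n)) := by
  have hb0 : b ≠ 0 := by omega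
  have hb' : (b : ℝ) ≠ 0 := by exact_mod_cast hb0
  have hσ : ∀ k, σ (Fin.rev k) = Fin.rev (σ k) := fun k => DFunLike.congr_fun hcomm k
  have hrev : ∀ i k, S i (Fin.rev k) = Fin.rev (S i k) := by
    intro i k
    rcases hS i with h | h <;> rw [h]
    · exact hσ k
    · exact congrArg Fin.rev (hσ k)
  have hcard : (Fintype.card (Bool × (Fin n → Fin b)) : ℝ) = 2 * (b : ℝ) ^ n := by
    simp
  have hfst : ∀ a, fstCoord (fun i => pbar (S i)) a = -fstCoord S a := fun a => by
    simp only [fstCoord, centered_pbar, neg_mul, sum_neg_distrib]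
  have hint := (isSymGrid_tuple hrev).integral_localDisc_sq (pow_ne_zero n hb0)
    (P := symFam b n S) (fun a => hammPt_eq hb0 S a)
    (fun a => by rw [← hfst]; exact hammPt_eq hb0 _ a)
  have hnonneg : 0 ≤ ∫ x in (0:ℝ)..1, ∫ y in (0:ℝ)..1, localDisc (symFam b n S) x y ^ 2 :=
    intervalIntegral.integral_nonneg zero_le_one fun x _ =>
      intervalIntegral.integral_nonneg zero_le_one fun y _ => sq_nonneg _
  have hN : (b : ℝ) ^ n ≠ 0 := pow_ne_zero n hb'
  rw [L2disc, hcard, ← mul_assoc, mul_one_div_cancel (mul_ne_zero two_ne_zero hN), one_mul,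
    Real.sq_sqrt hnonneg, hint, digit_constant_eq hσ hb0]
  obtain ⟨m, rfl⟩ := Nat.exists_eq_add_of_le' hn
  rw [energy_tuple hb0 hS hrev, mul_comm 2 (m + 1), pow_mul]
  push_cast
  field_simp
  ring

end SymHamm
end
end

section
/- Let b ≥ 2, n ≥ 1, σ a permutation of {0,…,b−1}, 1 ≤ N ≤ b^n and 1 ≤ i < j ≤ n. Then for any σ_i, σ_j ∈ {σ, σ̄} and any Σ_1, Σ_2 ∈ {σ,σ̄}^n (possibly different), ∑_{λ=1}^{b^n} φ_{b,ε_i(λ,N,Σ_1)}^{σ_i}(N/b^i) · φ_{b,ε_j(λ,N,Σ_2)}^{σ_j}(N/b^j) = b^{n−2} · φ_b^{σ_i}(N/b^i) · φ_b^{σ_j}(N/b^j). -/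
open Finset
open scoped Classical

noncomputable section

namespace SymHamm

lemma permVal_lt {b : ℕ} (hb : 0 < b) (σ : Equiv.Perm (Fin b)) (k : ℕ) : permVal σ k < b := by
  unfold permVal
  split_ifs with h
  · exact (σ ⟨k, h⟩).isLt
  · exact hb

lemma sum_digits_lt_pow {b : ℕ} (a : ℕ → ℕ) (ha : ∀ k, a k < b) (j n : ℕ) (hj : j ≤ n) :
    ∑ k ∈ range n, (if j ≤ k then a k * b ^ (n - 1 - k) else 0) < b ^ (n - j) := by
  induction n with
  | zero => simp
  | succ n ih =>
    rcases Nat.lt_or_ge n j with h | h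
    · obtain rfl : j = n + 1 := by omega
      rw [Finset.sum_eq_zero]
      · simp
      · intro k hk
        rw [if_neg]
        have := Finset.mem_range.1 hk
        omega
    · have hstep : ∑ k ∈ range n, (if j ≤ k then a k * b ^ (n + 1 - 1 - k) else 0) =
          (∑ k ∈ range n, (if j ≤ k then a k * b ^ (n - 1 - k) else 0)) * b := by
        rw [Finset.sum_mul]
        refine Finset.sum_congr rfl fun k hk => ?_
        have hk := Finset.mem_range.1 hk
        have he : n + 1 - 1 - k = (n - 1 - k) + 1 := by omega
        rw [he, pow_succ]
        split_ifs <;> ring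
      have hlast : n + 1 - 1 - n = 0 := by omega
      have hexp : n + 1 - j = (n - j) + 1 := by omega
      rw [Finset.sum_range_succ, hstep, if_pos h, hlast, hexp, pow_succ, pow_zero, mul_one]
      nlinarith [ih h, ha n]

lemma nu_lt_pow {b n : ℕ} (hb : 0 < b) (S : Fin n → Equiv.Perm (Fin b)) (N : ℕ) {j : ℕ}
    (hj : j ≤ n) : nu b n S N j < b ^ (n - j) := by
  have h := sum_digits_lt_pow
    (fun k => if hk : k < n then permVal (S ⟨k, hk⟩) ((N / b ^ k) % b) else 0)
    (fun k => by
      split_ifs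
      · exact permVal_lt hb _ _
      · exact hb) j n hj
  rw [← Fin.sum_univ_eq_sum_range
    (fun k => if j ≤ k then (if hk : k < n then permVal (S ⟨k, hk⟩) ((N / b ^ k) % b) else 0) *
      b ^ (n - 1 - k) else 0)] at h
  simpa [nu] using h

/-- Away from the exceptional cases, `ε_j` is a digit of a translate of `λ`. -/
lemma eps_eq_digit {b n : ℕ} (hb : 0 < b) (S : Fin n → Equiv.Perm (Fin b)) {lam N j : ℕ}
    (hj : j ≤ n) (hlam : lam ≠ b ^ n) (hN : N ≠ b ^ n) :
    eps b n S lam N j =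
      (lam + (b ^ (n - j) - 1 - nu b n S N j)) / b ^ (n - j) % b := by
  have hnu := nu_lt_pow hb S N hj
  rw [eps, if_neg (by tauto)]
  rcases eq_or_ne j n with rfl | hjn
  · simp only [Nat.sub_self, pow_zero] at hnu ⊢
    simp
  rw [if_neg hjn]
  have hdecomp : (lam + (b ^ (n - j) - 1 - nu b n S N j)) / b ^ (n - j) % b =
      (lam % b ^ (n - j + 1) + (b ^ (n - j) - 1 - nu b n S N j)) / b ^ (n - j) % b := by
    conv_lhs => rw [← Nat.mod_add_div lam (b ^ (n - j + 1))]
    have he : lam % b ^ (n - j + 1) + b ^ (n - j + 1) * (lam / b ^ (n - j + 1)) +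
        (b ^ (n - j) - 1 - nu b n S N j) =
        lam % b ^ (n - j + 1) + (b ^ (n - j) - 1 - nu b n S N j) +
          b ^ (n - j) * (b * (lam / b ^ (n - j + 1))) := by ring
    rw [he, Nat.add_mul_div_left _ _ (pow_pos hb _), Nat.add_mul_mod_self_left]
  rw [hdecomp]
  split_ifs with h
  · rw [Nat.div_eq_of_lt (by omega), Nat.zero_mod]
  · rw [← Nat.add_div_right _ (pow_pos hb _)]
    congr 2
    omega

lemma sum_range_add_of_periodic {F : ℕ → ℝ} {M : ℕ} (hF : Function.Periodic F M) (c : ℕ) :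
    ∑ k ∈ range M, F (k + c) = ∑ k ∈ range M, F k := by
  induction c with
  | zero => rfl
  | succ c ih =>
    rw [← ih]
    have h := (Finset.sum_range_succ (fun k => F (k + c)) M).symm.trans
      (Finset.sum_range_succ' (fun k => F (k + c)) M)
    have hM : F (M + c) = F c := by rw [add_comm]; exact hF c
    simp only [hM, zero_add, add_left_inj] at h
    rw [h]
    refine Finset.sum_congr rfl fun k _ => ?_
    rw [add_assoc, add_comm 1 c]

lemma sum_range_mul_eq (F : ℕ → ℝ) (q s : ℕ) :
    ∑ k ∈ range (q * s), F k = ∑ t ∈ range s, ∑ r ∈ range q, F (r + q * t) := by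
  induction s with
  | zero => simp
  | succ s ih =>
    rw [Nat.mul_succ, Finset.sum_range_add, ih, Finset.sum_range_succ]
    simp only [add_comm]

lemma sum_range_mul_mod (g : ℕ → ℝ) (b K : ℕ) :
    ∑ k ∈ range (b * K), g (k % b) = K * ∑ k ∈ range b, g k := by
  rw [sum_range_mul_eq]
  have h : ∀ t ∈ range K, ∑ r ∈ range b, g ((r + b * t) % b) = ∑ k ∈ range b, g k := by
    intro t _
    refine Finset.sum_congr rfl fun r hr => ?_
    rw [Nat.add_mul_mod_self_left, Nat.mod_eq_of_lt (Finset.mem_range.1 hr)]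
  rw [Finset.sum_congr rfl h]
  simp

lemma periodic_digit (g : ℕ → ℝ) {q : ℕ} (hq : 0 < q) (b K : ℕ) :
    Function.Periodic (fun k => g (k / q % b)) (q * (b * K)) := by
  intro k
  simp only [Nat.add_mul_div_left _ _ hq, Nat.add_mul_mod_self_left]

lemma sum_digit (g : ℕ → ℝ) {q : ℕ} (hq : 0 < q) (b K d : ℕ) :
    ∑ k ∈ range (q * (b * K)), g ((k + d) / q % b) = q * K * ∑ k ∈ range b, g k := by
  rw [sum_range_add_of_periodic (periodic_digit g hq b K), sum_range_mul_eq]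
  have h : ∀ t ∈ range (b * K), ∑ r ∈ range q, g ((r + q * t) / q % b) = q * g (t % b) := by
    intro t _
    rw [Finset.sum_congr rfl fun r hr => by
      rw [Nat.add_mul_div_left _ _ hq, Nat.div_eq_of_lt (Finset.mem_range.1 hr), zero_add]]
    simp
  rw [Finset.sum_congr rfl h, ← Finset.mul_sum, sum_range_mul_mod, mul_assoc]

/-- Two digits at different positions of translates of a uniform variable are independent. -/
lemma sum_digit_mul_digit (f g : ℕ → ℝ) {b q : ℕ} (hb : 0 < b) (hq : 0 < q) {K : ℕ} (hK : 0 < K)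
    (L : ℕ) {c : ℕ} (d : ℕ) (hc : c ≤ q * (b * K) * (b * L)) :
    ∑ k ∈ range (q * (b * K) * (b * L)),
        f ((k + c) / (q * (b * K)) % b) * g ((k + d) / q % b) =
      L * (∑ h ∈ range b, f h) * (q * K * ∑ h ∈ range b, g h) := by
  obtain ⟨e, he⟩ := Nat.exists_eq_add_of_le hc
  have hQ : 0 < q * (b * K) := by positivity
  have hg : ∀ k t, g ((k + q * (b * K) * t) / q % b) = g (k / q % b) := by
    intro k t
    rw [show q * (b * K) * t = q * (b * (K * t)) by ring]
    exact periodic_digit g hq b (K * t) k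
  have hshift : ∀ k, f ((k + c) / (q * (b * K)) % b) * g ((k + d) / q % b) =
      f ((k + c) / (q * (b * K)) % b) * g ((k + c + (e + d)) / q % b) := by
    intro k
    rw [← hg (k + d) (b * L), he]
    congr 4
    ring
  rw [Finset.sum_congr rfl fun k _ => hshift k,
    sum_range_add_of_periodic
      (F := fun k => f (k / (q * (b * K)) % b) * g ((k + (e + d)) / q % b)), sum_range_mul_eq]
  · have h : ∀ t ∈ range (b * L), ∑ r ∈ range (q * (b * K)),
        f ((r + q * (b * K) * t) / (q * (b * K)) % b) *
          g ((r + q * (b * K) * t + (e + d)) / q % b) =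
        f (t % b) * (q * K * ∑ h ∈ range b, g h) := by
      intro t _
      rw [← sum_digit g hq b K (e + d), Finset.mul_sum]
      refine Finset.sum_congr rfl fun r hr => ?_
      rw [Nat.add_mul_div_left _ _ hQ, Nat.div_eq_of_lt (Finset.mem_range.1 hr), zero_add,
        add_right_comm, hg]
    rw [Finset.sum_congr rfl h, ← Finset.sum_mul, sum_range_mul_mod]
  · intro k
    have hf := periodic_digit f hQ b L k
    simp only at hf
    simp only [hf]
    rw [add_right_comm, hg]

lemma phi_zero {b : ℕ} (σ : Equiv.Perm (Fin b)) (x : ℝ) : phi σ 0 x = 0 := by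
  simp [phi]

lemma phi_of_fract_eq_zero {b : ℕ} (σ : Equiv.Perm (Fin b)) (h : ℕ) {x : ℝ}
    (hx : Int.fract x = 0) : phi σ h x = 0 := by
  unfold phi
  simp only [hx, mul_zero, Int.floor_zero, Int.toNat_zero, zero_add, Finset.range_one, sub_zero,
    zero_sub]
  split_ifs with hh
  · simp [Finset.filter_singleton, not_lt.2 hh]
  · simp [Finset.filter_singleton, hh]

lemma fract_pow_div_pow {b : ℕ} (hb : 0 < b) {n i : ℕ} (hi : i ≤ n) :
    Int.fract (((b ^ n : ℕ) : ℝ) / (b : ℝ) ^ i) = 0 := by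
  have hb' : (b : ℝ) ≠ 0 := by positivity
  have h : ((b ^ n : ℕ) : ℝ) / (b : ℝ) ^ i = ((b ^ (n - i) : ℕ) : ℝ) := by
    push_cast
    rw [pow_sub₀ _ hb' hi, div_eq_mul_inv]
  rw [h, Int.fract_natCast]

theorem stmt4 (b : ℕ) (hb : 2 ≤ b) (n : ℕ) (hn : 1 ≤ n) (σ : Equiv.Perm (Fin b))
    (N : ℕ) (hN1 : 1 ≤ N) (hN2 : N ≤ b ^ n)
    (i j : ℕ) (hi : 1 ≤ i) (hij : i < j) (hj : j ≤ n)
    (σi σj : Equiv.Perm (Fin b))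
    (hσi : σi = σ ∨ σi = pbar σ) (hσj : σj = σ ∨ σj = pbar σ)
    (S1 S2 : Fin n → Equiv.Perm (Fin b))
    (hS1 : ∀ k, S1 k = σ ∨ S1 k = pbar σ) (hS2 : ∀ k, S2 k = σ ∨ S2 k = pbar σ) :
    ∑ lam ∈ Finset.Icc 1 (b ^ n),
        phi σi (eps b n S1 lam N i) ((N : ℝ) / (b : ℝ) ^ i) *
          phi σj (eps b n S2 lam N j) ((N : ℝ) / (b : ℝ) ^ j) =
      (b : ℝ) ^ (n - 2) * phiS σi ((N : ℝ) / (b : ℝ) ^ i) *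
        phiS σj ((N : ℝ) / (b : ℝ) ^ j) := by
  have hb0 : 0 < b := by omega
  rcases eq_or_ne N (b ^ n) with rfl | hN
  · have h1 : ∀ h, phi σi h (((b ^ n : ℕ) : ℝ) / (b : ℝ) ^ i) = 0 := fun h =>
      phi_of_fract_eq_zero σi h (fract_pow_div_pow hb0 (by omega))
    simp only [phiS, h1, zero_mul, mul_zero, Finset.sum_const_zero]
  have hsum : ∑ lam ∈ Finset.Icc 1 (b ^ n),
        phi σi (eps b n S1 lam N i) ((N : ℝ) / (b : ℝ) ^ i) *
          phi σj (eps b n S2 lam N j) ((N : ℝ) / (b : ℝ) ^ j) =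
      ∑ lam ∈ range (b ^ n), phi σi (eps b n S1 lam N i) ((N : ℝ) / (b : ℝ) ^ i) *
          phi σj (eps b n S2 lam N j) ((N : ℝ) / (b : ℝ) ^ j) := by
    have hzero : eps b n S1 0 N i = 0 := by simp [eps]
    have hlast : eps b n S1 (b ^ n) N i = 0 := by simp [eps]
    have hIcc : Finset.Icc 1 (b ^ n) = Finset.Ico 1 (b ^ n + 1) := by
      ext k
      simp only [Finset.mem_Icc, Finset.mem_Ico]
      omega
    rw [hIcc, Finset.sum_Ico_succ_top (Nat.one_le_pow _ _ hb0), Finset.range_eq_Ico,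
      Finset.sum_eq_sum_Ico_succ_bot (a := 0) (pow_pos hb0 n), hzero, hlast, phi_zero]
    ring
  have hqi : b ^ (n - i) = b ^ (n - j) * (b * b ^ (j - i - 1)) := by
    rw [← pow_succ', ← pow_add]
    congr 1
    omega
  have hM : b ^ n = b ^ (n - j) * (b * b ^ (j - i - 1)) * (b * b ^ (i - 1)) := by
    rw [← hqi, ← pow_succ', ← pow_add]
    congr 1
    omega
  have hc : b ^ (n - i) - 1 - nu b n S1 N i ≤
      b ^ (n - j) * (b * b ^ (j - i - 1)) * (b * b ^ (i - 1)) := by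
    rw [← hM]
    have := Nat.pow_le_pow_right hb0 (Nat.sub_le n i)
    omega
  have hmain := sum_digit_mul_digit (fun h => phi σi h ((N : ℝ) / (b : ℝ) ^ i))
    (fun h => phi σj h ((N : ℝ) / (b : ℝ) ^ j)) hb0 (pow_pos hb0 (n - j))
    (pow_pos hb0 (j - i - 1)) (b ^ (i - 1)) (b ^ (n - j) - 1 - nu b n S2 N j) hc
  rw [← hM, ← hqi] at hmain
  rw [hsum, Finset.sum_congr rfl fun lam hlam => by
    rw [eps_eq_digit hb0 S1 (by omega) (Finset.mem_range.1 hlam).ne hN,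
      eps_eq_digit hb0 S2 hj (Finset.mem_range.1 hlam).ne hN]]
  rw [hmain, phiS, phiS]
  have hexp : n - 2 = (i - 1) + (n - j) + (j - i - 1) := by omega
  rw [hexp]
  push_cast
  ring

end SymHamm
end
end
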